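/- arXiv:1505.03924 — 10 statements merged into one kernel-verified Lean document; each statement's English description precedes it below -/
import Mathlib

section
/- Let (S,d) be a (possibly asymmetric) clustering instance with optimal k-center cost r*, let α ≥ 1, and let d' be an α-perturbation of d with the property that for all p,q ∈ S, if d(p,q) ≥ r* then d'(p,q) ≥ α·r*. Then the optimal k-center cost under d' equals α·r*. -/
open Finset
open scoped Classical

/-- A `k`-clustering of a finite point set: `k` clusters with designated
distinct centers, each center belonging to its cluster, and the clusters
forming a partition of the point set. -/
structure Clustering (S : Type*) [Fintype S] (k : ℕ) where
  C : Fin k → Finset S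
  ctr : Fin k → S
  mem_ctr : ∀ i, ctr i ∈ C i
  ctr_inj : Function.Injective ctr
  covers : ∀ p : S, ∃ i, p ∈ C i
  disj : ∀ i j, i ≠ j → ∀ p, p ∈ C i → p ∉ C j

section Defs

variable {S : Type*} [Fintype S]

/-- `d` is a (possibly asymmetric) distance function: nonnegative, zero on the
diagonal, and satisfying the triangle inequality. -/
def IsQuasiMetric (d : S → S → ℝ) : Prop :=
  (∀ p q, 0 ≤ d p q) ∧ (∀ p, d p p = 0) ∧ (∀ p q r, d p r ≤ d p q + d q r)

/-- `d` is symmetric. -/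
def SymmDist (d : S → S → ℝ) : Prop := ∀ p q, d p q = d q p

/-- `d'` is an `α`-perturbation of `d`. -/
def IsPerturbation (α : ℝ) (d d' : S → S → ℝ) : Prop :=
  ∀ p q, d p q ≤ d' p q ∧ d' p q ≤ α * d p q

/-- The center set `Cs` covers every point within distance `r`
(i.e. the `k`-center cost of `Cs` is at most `r`). -/
def Covers (d : S → S → ℝ) (Cs : Finset S) (r : ℝ) : Prop :=
  ∀ p : S, ∃ c ∈ Cs, d c p ≤ r

/-- `r` is the optimal `k`-center cost for `(S, d)`. -/
def IsOptCost (d : S → S → ℝ) (k : ℕ) (r : ℝ) : Prop :=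
  (∃ Cs : Finset S, Cs.card = k ∧ Covers d Cs r) ∧
    ∀ (Cs : Finset S) (r' : ℝ), Cs.card = k → Covers d Cs r' → r ≤ r'

/-- Each point is assigned to a closest center (Voronoi partition). -/
def IsVoronoi (d : S → S → ℝ) {k : ℕ} (𝒞 : Clustering S k) : Prop :=
  ∀ i j, ∀ p ∈ 𝒞.C i, d (𝒞.ctr i) p ≤ d (𝒞.ctr j) p

/-- Every point is within distance `r` of the center of its cluster. -/
def HasRadius (d : S → S → ℝ) {k : ℕ} (𝒞 : Clustering S k) (r : ℝ) : Prop :=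
  ∀ i, ∀ p ∈ 𝒞.C i, d (𝒞.ctr i) p ≤ r

/-- `𝒞` is an optimal `k`-center clustering with optimal cost `r`: a Voronoi
partition induced by a set of `k` centers achieving the optimal cost. -/
def IsOptClustering (d : S → S → ℝ) (k : ℕ) (𝒞 : Clustering S k) (r : ℝ) : Prop :=
  IsVoronoi d 𝒞 ∧ HasRadius d 𝒞 r ∧ IsOptCost d k r

/-- Two clusterings are equal as partitions. -/
def SamePartition {k : ℕ} (𝒞 𝒞' : Clustering S k) : Prop :=
  ∃ σ : Equiv.Perm (Fin k), ∀ i, 𝒞.C i = 𝒞'.C (σ i)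

/-- `α`-perturbation resilience: under any `α`-perturbation, any optimal
clustering coincides with `𝒪` as a partition (so it is unique and equals `𝒪`). -/
def PerturbationResilient (d : S → S → ℝ) (k : ℕ) (α : ℝ) (𝒪 : Clustering S k) : Prop :=
  ∀ d' : S → S → ℝ, IsPerturbation α d d' →
    ∀ (𝒞 : Clustering S k) (r : ℝ), IsOptClustering d' k 𝒞 r → SamePartition 𝒞 𝒪

/-- `𝒞` and `𝒞'` agree on all but (at most) an `ε` fraction of the points. -/
def EpsClose {k : ℕ} (ε : ℝ) (𝒞 𝒞' : Clustering S k) : Prop :=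
  ∃ σ : Equiv.Perm (Fin k),
    (∑ i, (((𝒞.C i) \ (𝒞'.C (σ i))).card : ℝ)) ≤ ε * Fintype.card S

/-- `(α, ε)`-perturbation resilience: under any `α`-perturbation, any optimal
clustering is `ε`-close to `𝒪`. -/
def EpsPerturbationResilient (d : S → S → ℝ) (k : ℕ) (α ε : ℝ) (𝒪 : Clustering S k) : Prop :=
  ∀ d' : S → S → ℝ, IsPerturbation α d d' →
    ∀ (𝒞 : Clustering S k) (r : ℝ), IsOptClustering d' k 𝒞 r → EpsClose ε 𝒞 𝒪

/-- `(α, ε)`-approximation stability (`rstar` being the optimal radius): any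
`k`-partition with designated centers of cost at most `α · rstar` is `ε`-close to `𝒪`. -/
def ApproxStable (d : S → S → ℝ) (k : ℕ) (α ε rstar : ℝ) (𝒪 : Clustering S k) : Prop :=
  ∀ 𝒞 : Clustering S k, HasRadius d 𝒞 (α * rstar) → EpsClose ε 𝒞 𝒪

/-- The "symmetrized set" `A` of points behaving symmetrically up to distance `rstar`. -/
def SymSet (d : S → S → ℝ) (rstar : ℝ) : Set S :=
  {p | ∀ q, d q p ≤ rstar → d p q ≤ rstar}

end Defs

/-- Every set of `k` centers leaves some point at distance at least the optimal cost. -/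
theorem exists_forall_le_of_card_eq {S : Type*} [Fintype S] {d : S → S → ℝ} {k : ℕ} {r : ℝ}
    (hmin : ∀ (Cs : Finset S) (r' : ℝ), Cs.card = k → Covers d Cs r' → r ≤ r')
    {Cs : Finset S} (hCs : Cs.card = k) : ∃ p, ∀ c ∈ Cs, r ≤ d c p := by
  by_contra! h
  choose f hf hlt using h
  have hev : ∀ᶠ M in nhdsWithin r (Set.Iio r), ∀ p, d (f p) p ≤ M :=
    Filter.eventually_all.2 fun p =>
      ((lt_mem_nhds (hlt p)).mono fun _ h => le_of_lt h).filter_mono nhdsWithin_le_nhds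
  obtain ⟨M, hM, hMr⟩ := (hev.and self_mem_nhdsWithin).exists
  exact (hmin Cs M hCs fun p => ⟨f p, hf p, hM p⟩).not_gt hMr

/-- If `d'` is an `α`-perturbation of `d` (with `α ≥ 1`) such that
`d p q ≥ r*` implies `d' p q ≥ α·r*`, then the optimal `k`-center cost under `d'`
is exactly `α·r*`. -/
theorem optimal_cost_under_special_perturbation {S : Type*} [Fintype S]
    (d d' : S → S → ℝ) (k : ℕ) (α rstar : ℝ)
    (hmet : IsQuasiMetric d) (hα : 1 ≤ α)
    (hopt : IsOptCost d k rstar)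
    (hpert : IsPerturbation α d d')
    (hprop : ∀ p q : S, rstar ≤ d p q → α * rstar ≤ d' p q) :
    IsOptCost d' k (α * rstar) := by
  obtain ⟨⟨Cs, hcard, hcov⟩, hmin⟩ := hopt
  refine ⟨⟨Cs, hcard, fun p => ?_⟩, fun Ds r' hDs hr' => ?_⟩
  · obtain ⟨c, hc, hcp⟩ := hcov p
    exact ⟨c, hc, (hpert c p).2.trans (mul_le_mul_of_nonneg_left hcp (zero_le_one.trans hα))⟩
  · obtain ⟨p, hp⟩ := exists_forall_le_of_card_eq hmin hDs
    obtain ⟨c, hc, hcp⟩ := hr' p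
    exact (hprop c p (hp c hc)).trans hcp
end

section
/- Let (S,d) be a (possibly asymmetric) clustering instance satisfying α-perturbation resilience for k-center (α ≥ 1), and let C ⊆ S be a set of k centers such that for every p ∈ S there exists c ∈ C with d(c,p) ≤ α·r*. Then any assignment of each point of S to a center c ∈ C minimizing d(c,p) yields exactly the partition OPT. -/
open Finset
open scoped Classical

/-- Under `α`-perturbation resilience, the Voronoi partition induced
by any set of `k` centers which is an `α`-approximation is the optimal clustering. -/
theorem approximation_gives_optimal_clustering {S : Type*} [Fintype S]
    (d : S → S → ℝ) (k : ℕ) (α rstar : ℝ)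
    (hmet : IsQuasiMetric d) (hα : 1 ≤ α)
    (OPT : Clustering S k) (hOPT : IsOptClustering d k OPT rstar)
    (hres : PerturbationResilient d k α OPT)
    (Cs : Finset S) (hcard : Cs.card = k)
    (happrox : Covers d Cs (α * rstar))
    (𝒞 : Clustering S k) (hctr : ∀ i, 𝒞.ctr i ∈ Cs)
    (hvor : IsVoronoi d 𝒞) :
    SamePartition 𝒞 OPT := by
  obtain ⟨hnonneg, -, -⟩ := hmet
  obtain ⟨-, -, ⟨-, hmin⟩⟩ := hOPT
  have hα0 : 0 < α := by linarith
  have himage : univ.image 𝒞.ctr = Cs := by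
    refine eq_of_subset_of_card_le ?_ ?_
    · intro c hc
      obtain ⟨i, -, rfl⟩ := mem_image.mp hc
      exact hctr i
    · rw [card_image_of_injective _ 𝒞.ctr_inj, hcard, card_univ, Fintype.card_fin]
  have hshort : ∀ p q, d p q ≤ α * rstar →
      min (α * d p q) (max (d p q) (α * rstar)) ≤ α * rstar :=
    fun p q h => (min_le_right _ _).trans (max_le h le_rfl)
  refine hres (fun p q => min (α * d p q) (max (d p q) (α * rstar))) ?_ 𝒞 (α * rstar)
    ⟨?_, ?_, ⟨Cs, hcard, ?_⟩, ?_⟩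
  · intro p q
    exact ⟨le_min (le_mul_of_one_le_left (hnonneg p q) hα) (le_max_left _ _), min_le_left _ _⟩
  · intro i j p hp
    have h := hvor i j p hp
    exact min_le_min (mul_le_mul_of_nonneg_left h hα0.le) (max_le_max_right _ h)
  · intro i p hp
    obtain ⟨c, hc, hcp⟩ := happrox p
    rw [← himage] at hc
    obtain ⟨j, -, rfl⟩ := mem_image.mp hc
    exact hshort _ _ ((hvor i j p hp).trans hcp)
  · intro p
    obtain ⟨c, hc, hcp⟩ := happrox p
    exact ⟨c, hc, hshort _ _ hcp⟩
  · intro Ds r hDs hcov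
    by_contra! hr
    have hle : rstar ≤ r / α := by
      refine hmin Ds _ hDs fun p => ?_
      obtain ⟨c, hc, hcp⟩ := hcov p
      refine ⟨c, hc, ?_⟩
      rw [le_div_iff₀' hα0]
      rcases min_le_iff.mp hcp with h | h
      · exact h
      · exact absurd ((le_max_right _ _).trans h) hr.not_ge
    rw [le_div_iff₀' hα0] at hle
    exact hr.not_ge hle
end

section
/- Let α ≥ 1 and ε > 0, and let (S,d) be a (possibly asymmetric) clustering instance satisfying (α,ε)-perturbation resilience for k-center in which every optimal cluster has size > 2εn. Then for every α-perturbation d' of d, every set of k centers that is optimal for k-center under d', and every assignment of each point of S to one of its d'-closest centers among these k centers, for each optimal cluster C_i there is a (necessarily unique) center that is assigned more than half of the points of C_i. -/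
open Finset
open scoped Classical

section AssignmentClustering

variable {S : Type*}

/-- The clustering given by an assignment of the points to the centers `Cs` which
fixes every center. -/
noncomputable def Clustering.ofAssignment [Fintype S] {k : ℕ} {Cs : Finset S}
    (e : Fin k ≃ Cs) (b : S → S)
    (hb : ∀ p, b p ∈ Cs) (hfix : ∀ c ∈ Cs, b c = c) : Clustering S k where
  C j := univ.filter fun p => b p = e j
  ctr j := e j
  mem_ctr j := by simpa using hfix _ (e j).2
  ctr_inj := Subtype.val_injective.comp e.injective
  covers p := ⟨e.symm ⟨b p, hb p⟩, by simp⟩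
  disj i j hij p hi hj := by
    simp only [mem_filter, mem_univ, true_and] at hi hj
    exact hij (e.injective (Subtype.ext (hi.symm.trans hj)))

/-- If `𝒞` is `ε`-close to `𝒪` through the matching `σ`, then each cluster of `𝒪` is contained
in the matched cluster of `𝒞` up to `ε n` points. -/
theorem Clustering.card_sdiff_le_of_sum_le [Fintype S] {k : ℕ} {ε : ℝ} {𝒞 𝒪 : Clustering S k}
    {σ : Equiv.Perm (Fin k)}
    (h : (∑ i, (((𝒞.C i) \ (𝒪.C (σ i))).card : ℝ)) ≤ ε * Fintype.card S) (j : Fin k) :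
    ((𝒪.C (σ j) \ 𝒞.C j).card : ℝ) ≤ ε * Fintype.card S := by
  have hsub : 𝒪.C (σ j) \ 𝒞.C j ⊆ univ.biUnion fun l => 𝒞.C l \ 𝒪.C (σ l) := by
    intro p hp
    rw [mem_sdiff] at hp
    obtain ⟨l, hl⟩ := 𝒞.covers p
    have hlj : σ j ≠ σ l := fun hjl => hp.2 (σ.injective hjl ▸ hl)
    exact mem_biUnion.2 ⟨l, mem_univ l, mem_sdiff.2 ⟨hl, 𝒪.disj _ _ hlj p hp.1⟩⟩
  refine le_trans ?_ h
  exact_mod_cast (card_le_card hsub).trans card_biUnion_le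

/-- Under perturbation resilience, an optimal set of centers together with a closest-center
assignment fixing the centers is matched bijectively to the clusters of `OPT`, each of which is
assigned to its matched center up to `ε n` points. -/
theorem EpsPerturbationResilient.exists_equiv_card_filter_ne_le
    [Fintype S] {d d' : S → S → ℝ} {k : ℕ} {α ε x : ℝ} {OPT : Clustering S k}
    (hres : EpsPerturbationResilient d k α ε OPT) (hpert : IsPerturbation α d d')
    {Cs : Finset S} (hcard : Cs.card = k) (hcov : Covers d' Cs x) (hoptc : IsOptCost d' k x)
    {b : S → S} (hb : ∀ p, b p ∈ Cs) (hfix : ∀ c ∈ Cs, b c = c)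
    (hmin : ∀ p, ∀ c ∈ Cs, d' (b p) p ≤ d' c p) :
    ∃ g : Fin k ≃ Cs, ∀ i,
      (((OPT.C i).filter fun p => b p ≠ g i).card : ℝ) ≤ ε * Fintype.card S := by
  let e : Fin k ≃ Cs := (Cs.equivFinOfCardEq hcard).symm
  let 𝒞 := Clustering.ofAssignment e b hb hfix
  have hC : ∀ {j p}, p ∈ 𝒞.C j → b p = e j := fun hp => (mem_filter.1 hp).2
  have hopt : IsOptClustering d' k 𝒞 x := by
    refine ⟨fun i j p hp => ?_, fun i p hp => ?_, hoptc⟩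
    · change d' (e i) p ≤ d' (e j) p
      rw [← hC hp]
      exact hmin p _ (e j).2
    · change d' (e i) p ≤ x
      rw [← hC hp]
      obtain ⟨c, hc, hcx⟩ := hcov p
      exact (hmin p c hc).trans hcx
  obtain ⟨σ, hσ⟩ := hres d' hpert 𝒞 x hopt
  refine ⟨σ.symm.trans e, fun i => ?_⟩
  have hle := Clustering.card_sdiff_le_of_sum_le hσ (σ.symm i)
  rw [Equiv.apply_symm_apply] at hle
  refine le_trans ?_ hle
  refine Nat.cast_le.2 (card_le_card fun p hp => ?_)
  rw [mem_filter] at hp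
  exact mem_sdiff.2 ⟨hp.1, fun h => hp.2 (hC h)⟩

/-- The largest perturbation of `d` that does not push a distance past the threshold `x`. -/
noncomputable def clippedDist (d : S → S → ℝ) (α x : ℝ) (p q : S) : ℝ :=
  max (d p q) (min x (α * d p q))

theorem clippedDist_le_clippedDist {d : S → S → ℝ} {α x : ℝ} (hα : 0 ≤ α) {p q r s : S}
    (h : d p q ≤ d r s) : clippedDist d α x p q ≤ clippedDist d α x r s :=
  max_le_max h (min_le_min le_rfl (mul_le_mul_of_nonneg_left h hα))

theorem isPerturbation_clippedDist {d : S → S → ℝ} {α : ℝ} (hd : ∀ p q, 0 ≤ d p q)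
    (hα : 1 ≤ α) (x : ℝ) : IsPerturbation α d (clippedDist d α x) := fun p q =>
  ⟨le_max_left _ _, max_le (le_mul_of_one_le_left (hd p q) hα) (min_le_right _ _)⟩

theorem Covers.clippedDist {d d' : S → S → ℝ} {α x : ℝ} (hpert : IsPerturbation α d d')
    {Cs : Finset S} (hcov : Covers d' Cs x) : Covers (clippedDist d α x) Cs x := fun p => by
  obtain ⟨c, hc, hcx⟩ := hcov p
  exact ⟨c, hc, max_le ((hpert c p).1.trans hcx) (min_le_left _ _)⟩

theorem IsOptCost.clippedDist {d d' : S → S → ℝ} {k : ℕ} {α x : ℝ}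
    (hpert : IsPerturbation α d d') (hoptc : IsOptCost d' k x) :
    IsOptCost (clippedDist d α x) k x := by
  obtain ⟨⟨Cs, hcard, hcov⟩, hlow⟩ := hoptc
  refine ⟨⟨Cs, hcard, hcov.clippedDist hpert⟩, fun Cs' r hcard' hcov' => ?_⟩
  by_contra! hr
  refine hr.not_ge (hlow Cs' r hcard' fun p => ?_)
  obtain ⟨c, hc, hcr⟩ := hcov' p
  have hmin : min x (α * d c p) ≤ r := (le_max_right _ _).trans hcr
  exact ⟨c, hc, (hpert c p).2.trans ((min_le_iff.1 hmin).resolve_left hr.not_ge)⟩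

/-- Under perturbation resilience with large optimal clusters, a center at distance zero from
another center of an optimal set of centers is an optimal cluster on its own. -/
theorem EpsPerturbationResilient.exists_eq_singleton
    [Fintype S] {d d' : S → S → ℝ} {k : ℕ} {α ε x : ℝ} {OPT : Clustering S k}
    (hmet : IsQuasiMetric d) (hα : 1 ≤ α)
    (hres : EpsPerturbationResilient d k α ε OPT)
    (hsize : ∀ i, 2 * ε * Fintype.card S < ((OPT.C i).card : ℝ))
    (hpert : IsPerturbation α d d')
    {Cs : Finset S} (hcard : Cs.card = k) (hcov : Covers d' Cs x) (hoptc : IsOptCost d' k x)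
    {s p : S} (hs : s ∈ Cs) (hp : p ∈ Cs) (hsp : s ≠ p) (hzero : d s p = 0) :
    ∃ i, OPT.C i = {p} := by
  obtain ⟨hnonneg, hdiag, htri⟩ := hmet
  have hα0 : 0 ≤ α := zero_le_one.trans hα
  have hne : (Cs.erase p).Nonempty := ⟨s, mem_erase.2 ⟨hsp, hs⟩⟩
  choose m hm hmmin using fun q =>
    (Cs.erase p).exists_min_image (fun c => clippedDist d α x c q) hne
  let b : S → S := fun q => if q ∈ Cs then q else m q
  have hb : ∀ q, b q ∈ Cs := fun q => by
    by_cases hq : q ∈ Cs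
    · simp [b, hq]
    · simpa [b, hq] using mem_of_mem_erase (hm q)
  have hfix : ∀ c ∈ Cs, b c = c := fun c hc => by simp [b, hc]
  have hmin : ∀ q, ∀ c ∈ Cs, clippedDist d α x (b q) q ≤ clippedDist d α x c q := by
    intro q c hc
    by_cases hq : q ∈ Cs
    · rw [hfix q hq]
      exact clippedDist_le_clippedDist hα0 ((hdiag q).trans_le (hnonneg c q))
    · have hbq : b q = m q := by simp [b, hq]
      rw [hbq]
      by_cases hcp : c = p
      · have hle : d s q ≤ d c q := by
          have := htri s p q
          rw [hcp]
          linarith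
        exact (hmmin q s (mem_erase.2 ⟨hsp, hs⟩)).trans (clippedDist_le_clippedDist hα0 hle)
      · exact hmmin q c (mem_erase.2 ⟨hcp, hc⟩)
  have heq : ∀ q, b q = p → q = p := by
    intro q hq
    by_cases hqC : q ∈ Cs
    · rwa [hfix q hqC] at hq
    · simp only [b, hqC, if_false] at hq
      exact absurd hq (mem_erase.1 (hm q)).1
  obtain ⟨g, hg⟩ := hres.exists_equiv_card_filter_ne_le
    (isPerturbation_clippedDist hnonneg hα x) hcard (hcov.clippedDist hpert)
    (hoptc.clippedDist hpert) hb hfix hmin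
  let i := g.symm ⟨p, hp⟩
  have hgi : (g i : S) = p := by simp [i]
  have hsplit := card_filter_add_card_filter_not (s := OPT.C i) (fun q => b q = p)
  have hone : (OPT.C i).filter (fun q => b q = p) ⊆ {p} := fun q hq =>
    mem_singleton.2 (heq q (mem_filter.1 hq).2)
  have hone' : ((OPT.C i).filter (fun q => b q = p)).card ≤ 1 := by
    simpa using card_le_card hone
  have hbad := hg i
  rw [hgi] at hbad
  have hbig := hsize i
  have hzero' : ((OPT.C i).filter (fun q => b q ≠ p)).card = 0 := by
    rw [← hsplit] at hbig
    push_cast at hbig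
    have h1 : (((OPT.C i).filter (fun q => b q = p)).card : ℝ) ≤ 1 := by exact_mod_cast hone'
    have h2 : (((OPT.C i).filter (fun q => b q ≠ p)).card : ℝ) < 1 := by
      linarith
    exact_mod_cast Nat.lt_one_iff.1 (by exact_mod_cast h2)
  refine ⟨i, (OPT.C i).eq_singleton_iff_nonempty_unique_mem.2
    ⟨⟨_, OPT.mem_ctr i⟩, fun q hq => heq q ?_⟩⟩
  by_contra hbq
  exact notMem_empty q (card_eq_zero.1 hzero' ▸ mem_filter.2 ⟨hq, hbq⟩)

end AssignmentClustering

/-- At most one fibre of `a` contains more than half of `s`. -/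
theorem Finset.eq_of_card_lt_two_mul_card_filter {α β : Type*} {s : Finset α} {a : α → β}
    {c c' : β} (h : s.card < 2 * (s.filter fun p => a p = c).card)
    (h' : s.card < 2 * (s.filter fun p => a p = c').card) : c = c' := by
  by_contra hcc
  have hdisj : Disjoint (s.filter fun p => a p = c) (s.filter fun p => a p = c') :=
    disjoint_filter.2 fun p _ hp hp' => hcc (hp.symm.trans hp')
  have hle := card_le_card (union_subset (filter_subset (fun p => a p = c) s)
    (filter_subset (fun p => a p = c') s))
  rw [card_union_of_disjoint hdisj] at hle
  omega

/-- Under `(α, ε)`-perturbation resilience with all optimal clusters of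
size `> 2εn`, for any `α`-perturbation `d'`, any optimal set of `k` centers under `d'`,
and any assignment of points to closest centers, each optimal cluster `C_i` has a
unique center which is assigned more than half of the points of `C_i`. -/
theorem majority_center_exists {S : Type*} [Fintype S]
    (d d' : S → S → ℝ) (k : ℕ) (α ε rstar x : ℝ)
    (hmet : IsQuasiMetric d) (hα : 1 ≤ α) (hε : 0 < ε)
    (OPT : Clustering S k) (hOPT : IsOptClustering d k OPT rstar)
    (hres : EpsPerturbationResilient d k α ε OPT)
    (hsize : ∀ i, 2 * ε * Fintype.card S < ((OPT.C i).card : ℝ))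
    (hpert : IsPerturbation α d d')
    (Cs : Finset S) (hcard : Cs.card = k)
    (hcov : Covers d' Cs x) (hoptc : IsOptCost d' k x)
    (a : S → S) (haC : ∀ p, a p ∈ Cs)
    (hmin : ∀ p, ∀ c ∈ Cs, d' (a p) p ≤ d' c p)
    (i : Fin k) :
    ∃! c, c ∈ Cs ∧
      (OPT.C i).card < 2 * ((OPT.C i).filter (fun p => a p = c)).card := by
  refine existsUnique_of_exists_of_unique ?_ fun c c' hc hc' =>
    eq_of_card_lt_two_mul_card_filter hc.2 hc'.2
  have hd'0 : ∀ p q, 0 ≤ d' p q := fun p q => (hmet.1 p q).trans (hpert p q).1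
  have hd'diag : ∀ p, d' p p ≤ 0 := fun p => by
    simpa [hmet.2.1 p] using (hpert p p).2
  by_cases hmoved : ∃ p ∈ OPT.C i, p ∈ Cs ∧ a p ≠ p
  · obtain ⟨p, hpi, hpC, hap⟩ := hmoved
    have hzero : d (a p) p = 0 := le_antisymm
      (((hpert _ _).1.trans (hmin p p hpC)).trans (hd'diag p)) (hmet.1 _ _)
    obtain ⟨j, hj⟩ := hres.exists_eq_singleton hmet hα hsize hpert hcard hcov hoptc
      (haC p) hpC hap hzero
    have hij : i = j := by
      by_contra hij
      exact OPT.disj i j hij p hpi (by simp [hj])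
    exact ⟨a p, haC p, by simp [hij, hj, filter_singleton]⟩
  · push Not at hmoved
    let b : S → S := fun q => if q ∈ Cs then q else a q
    have hfix : ∀ c ∈ Cs, b c = c := fun c hc => by simp [b, hc]
    have hba : ∀ q, q ∉ Cs → b q = a q := fun q hq => by simp [b, hq]
    have hb : ∀ q, b q ∈ Cs := fun q => by
      by_cases hq : q ∈ Cs
      · rwa [hfix q hq]
      · rw [hba q hq]
        exact haC q
    have hbmin : ∀ q, ∀ c ∈ Cs, d' (b q) q ≤ d' c q := fun q c hc => by
      by_cases hq : q ∈ Cs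
      · rw [hfix q hq]
        exact (hd'diag q).trans (hd'0 c q)
      · rw [hba q hq]
        exact hmin q c hc
    have hab : ∀ q ∈ OPT.C i, b q = a q := fun q hq => by
      by_cases hqC : q ∈ Cs
      · rw [hfix q hqC, hmoved q hq hqC]
      · exact hba q hqC
    obtain ⟨g, hg⟩ := hres.exists_equiv_card_filter_ne_le hpert hcard hcov hoptc hb hfix hbmin
    refine ⟨g i, (g i).2, ?_⟩
    have hbad := hg i
    have hbig := hsize i
    rw [filter_congr fun q hq => by rw [hab q hq]] at hbad
    have hsplit := card_filter_add_card_filter_not (s := OPT.C i) (fun q => a q = g i)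
    have hlt : 2 * ((OPT.C i).filter fun q => a q ≠ g i).card < (OPT.C i).card := by
      have : (2 * ((OPT.C i).filter fun q => a q ≠ g i).card : ℝ) < (OPT.C i).card := by
        linarith
      exact_mod_cast this
    simp only [ne_eq] at hlt
    omega
end

section
/- Let (S,d) be a symmetric clustering instance satisfying (3,ε)-perturbation resilience for k-center in which every optimal cluster has size > max(2εn, 3). Then the optimal clusters C_1,…,C_k are exactly the connected components of the threshold graph G_{r*} on vertex set S with an edge between p and q whenever d(p,q) ≤ r*. -/
open Finset
open scoped Classical

/-- The perturbation raising every distance to `min (3 d) ρ`. -/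
lemma isPerturbation_max_min {S : Type*} {d : S → S → ℝ} (hd : ∀ p q, 0 ≤ d p q) (ρ : ℝ) :
    IsPerturbation 3 d fun p q => max (d p q) (min (3 * d p q) ρ) := fun p q =>
  ⟨le_max_left _ _, max_le (by linarith [hd p q]) (min_le_left _ _)⟩

/-- The metric and combinatorial facts about a resilient instance used below: `cl` is the map
sending a point to the index of its optimal cluster, and `close` says that every assignment `g` of
points to a `k`-set of centers which is optimal for the perturbation `max d (min (3 d) ρ)`
agrees with `cl` on all but `μ` points, up to relabelling. -/
structure StableInstance {S : Type*} [Fintype S] {k : ℕ} (d : S → S → ℝ) (r μ : ℝ)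
    (cl : S → Fin k) : Prop where
  nonneg : ∀ p q, 0 ≤ d p q
  self : ∀ p, d p p = 0
  tri : ∀ p q s, d p s ≤ d p q + d q s
  symm : ∀ p q, d p q = d q p
  two_mul_lt_card : ∀ m, 2 * μ < (#{x | cl x = m} : ℝ)
  three_lt_card : ∀ m, 3 < #{x | cl x = m}
  opt_le : ∀ (Cs : Finset S) (r' : ℝ), Cs.card = k → Covers d Cs r' → r ≤ r'
  near : ∀ v, ∃ y, y ≠ v ∧ cl y = cl v ∧ d v y ≤ r
  close : ∀ (X : Finset S) (g : S → S) (ρ : ℝ), X.card = k → ρ ≤ 3 * r → (∀ x, g x ∈ X) →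
    (∀ x ∈ X, g x = x) → (∀ x, d (g x) x ≤ ρ) →
    (∀ x, ∀ c ∈ X, d (g x) x ≤ d c x ∨ ρ / 3 ≤ d c x) →
    ∃ τ : S → Fin k, Set.InjOn τ X ∧ (#{x | cl x ≠ τ (g x)} : ℝ) ≤ μ

section StableInstance

variable {S : Type*} [Fintype S] {k : ℕ} {d : S → S → ℝ} {r μ : ℝ} {cl : S → Fin k}

/-- All but `μ` points of cluster `m` satisfy `P`. -/
def MostOf (μ : ℝ) (cl : S → Fin k) (m : Fin k) (P : S → Prop) : Prop :=
  (#{x | cl x = m ∧ ¬ P x} : ℝ) ≤ μ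

/-- All but `μ` points of cluster `m` are at distance less than `δ` from `v`. -/
def Captures (d : S → S → ℝ) (μ : ℝ) (cl : S → Fin k) (v : S) (δ : ℝ) (m : Fin k) : Prop :=
  MostOf μ cl m fun x => d v x < δ

/-- All but `μ` points of cluster `m` are equal to `s`, or closer to `s` than both `ρ / 3` and
their distance to `u`. -/
def CapturesFrom (d : S → S → ℝ) (μ : ℝ) (cl : S → Fin k) (s u : S) (ρ : ℝ) (m : Fin k) : Prop :=
  MostOf μ cl m fun x => x = s ∨ d s x < ρ / 3 ∧ d s x < d u x

lemma MostOf.mono {m : Fin k} {P Q : S → Prop} (hP : MostOf μ cl m P) (hPQ : ∀ x, P x → Q x) :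
    MostOf μ cl m Q := by
  refine le_trans (Nat.cast_le.2 (card_le_card fun x hx => ?_)) hP
  simp only [mem_filter, mem_univ, true_and] at hx ⊢
  exact ⟨hx.1, fun hx' => hx.2 (hPQ x hx')⟩

lemma mostOf_of_card_le {lab : S → Fin k} {m : Fin k} {P : S → Prop}
    (hlab : (#{x | cl x ≠ lab x} : ℝ) ≤ μ) (hP : ∀ x, lab x = m → P x) : MostOf μ cl m P := by
  refine le_trans (Nat.cast_le.2 (card_le_card fun x hx => ?_)) hlab
  simp only [mem_filter, mem_univ, true_and] at hx ⊢
  exact fun heq => hx.2 (hP x (heq.symm.trans hx.1))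

lemma CapturesFrom.mono {s u : S} {ρ ρ' : ℝ} {m : Fin k} (hc : CapturesFrom d μ cl s u ρ m)
    (hρ : ρ ≤ ρ') : CapturesFrom d μ cl s u ρ' m :=
  MostOf.mono hc fun _ hx => hx.imp_right fun hx => ⟨hx.1.trans_le (by linarith), hx.2⟩

namespace StableInstance

/-- Two properties of most points of a cluster hold simultaneously somewhere on that cluster. -/
lemma exists_both (h : StableInstance d r μ cl) {m : Fin k} {P Q : S → Prop}
    (hP : MostOf μ cl m P) (hQ : MostOf μ cl m Q) : ∃ x, cl x = m ∧ P x ∧ Q x := by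
  by_contra! hcon
  have hsub : ({x | cl x = m} : Finset S) ⊆
      ({x | cl x = m ∧ ¬ P x} : Finset S) ∪ ({x | cl x = m ∧ ¬ Q x} : Finset S) := by
    intro x hx
    simp only [mem_filter, mem_univ, true_and, mem_union] at hx ⊢
    by_cases hp : P x
    · exact Or.inr ⟨hx, hcon x hx hp⟩
    · exact Or.inl ⟨hx, hp⟩
  have hle : (#{x | cl x = m} : ℝ) ≤ #{x | cl x = m ∧ ¬ P x} + #{x | cl x = m ∧ ¬ Q x} := by
    exact_mod_cast (card_le_card hsub).trans (card_union_le _ _)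
  unfold MostOf at hP hQ
  linarith [h.two_mul_lt_card m]

/-- A property of most points of a cluster holds at a point of the cluster outside any set meeting
the cluster in at most two points. -/
lemma exists_notMem (h : StableInstance d r μ cl) {m : Fin k} {P : S → Prop}
    (hP : MostOf μ cl m P) (Z : Finset S) (hZ : #{x ∈ Z | cl x = m} ≤ 2) :
    ∃ x, cl x = m ∧ x ∉ Z ∧ P x := by
  by_contra! hcon
  have hsub : ({x | cl x = m} : Finset S) ⊆
      ({x | cl x = m ∧ ¬ P x} : Finset S) ∪ {x ∈ Z | cl x = m} := by
    intro x hx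
    simp only [mem_filter, mem_univ, true_and, mem_union] at hx ⊢
    by_cases hz : x ∈ Z
    · exact Or.inr ⟨hz, hx⟩
    · exact Or.inl ⟨hx, hcon x hx hz⟩
  have hle := (card_le_card hsub).trans (card_union_le _ _)
  have h1 : (#{x | cl x = m} : ℝ) ≤ #{x | cl x = m ∧ ¬ P x} + 2 := by
    exact_mod_cast hle.trans (by omega)
  have h3 : (4 : ℝ) ≤ #{x | cl x = m} := by exact_mod_cast h.three_lt_card m
  unfold MostOf at hP
  linarith [h.two_mul_lt_card m]

lemma exists_ne (h : StableInstance d r μ cl) {m : Fin k} {P : S → Prop}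
    (hP : MostOf μ cl m P) (v : S) : ∃ x, cl x = m ∧ x ≠ v ∧ P x := by
  obtain ⟨x, hx, hxv, hPx⟩ := h.exists_notMem hP {v}
    ((card_filter_le _ _).trans (by simp))
  exact ⟨x, hx, by simpa using hxv, hPx⟩

lemma pos_of_capturesFrom (h : StableInstance d r μ cl) {s u : S} {ρ : ℝ} {m : Fin k}
    (hc : CapturesFrom d μ cl s u ρ m) : 0 < ρ := by
  obtain ⟨x, -, hxs, hx⟩ := h.exists_ne hc s
  have := h.nonneg s x
  rcases hx with hx | hx
  · exact absurd hx hxs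
  · linarith [hx.1]

lemma captures_of_capturesFrom (h : StableInstance d r μ cl) {s u : S} {ρ : ℝ} {m : Fin k}
    (hc : CapturesFrom d μ cl s u ρ m) : Captures d μ cl s (ρ / 3) m := by
  have hρ := h.pos_of_capturesFrom hc
  refine MostOf.mono hc fun x hx => ?_
  rcases hx with rfl | hx
  · rw [h.self]; positivity
  · exact hx.1

lemma pos_of_captures (h : StableInstance d r μ cl) {s : S} {δ : ℝ} {m : Fin k}
    (hc : Captures d μ cl s δ m) : 0 < δ := by
  obtain ⟨x, -, -, hx⟩ := h.exists_ne hc s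
  exact (h.nonneg s x).trans_lt hx

lemma dist_lt_of_captures (h : StableInstance d r μ cl) {s t : S} {δ δ' : ℝ} {m : Fin k}
    (hs : Captures d μ cl s δ m) (ht : Captures d μ cl t δ' m) : d s t < δ + δ' := by
  obtain ⟨x, -, h1, h2⟩ := h.exists_both hs ht
  have := h.tri s x t
  rw [h.symm x t] at this
  linarith

/-- The clustering obtained by adding to `Z` a center `s` which loses all ties: `s` captures some
cluster `m`, and all the other clusters are captured by the Voronoi cells of `Z`. -/
lemma exists_labelling (h : StableInstance d r μ cl) {Z : Finset S} {ρ : ℝ} (hZ : #Z + 1 = k)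
    (hρ : ρ ≤ 3 * r) {f : S → S} (hfZ : ∀ x, f x ∈ Z) (hfid : ∀ x ∈ Z, f x = x)
    (hfρ : ∀ x, d (f x) x ≤ ρ) (hfmin : ∀ x, ∀ z ∈ Z, d (f x) x ≤ d z x) {s : S} (hs : s ∉ Z) :
    ∃ τ : S → Fin k, Set.InjOn τ (insert s Z : Finset S) ∧
      MostOf μ cl (τ s) (fun x => x = s ∨ d s x < ρ / 3 ∧ d s x < d (f x) x) ∧
      ∀ z ∈ Z, MostOf μ cl (τ z) (fun x => f x = z) := by
  set A : S → Prop := fun x => x = s ∨ d s x < ρ / 3 ∧ d s x < d (f x) x with hA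
  set g : S → S := fun x => if A x then s else f x with hg
  have gpos : ∀ x, A x → g x = s := fun x hx => if_pos hx
  have gneg : ∀ x, ¬ A x → g x = f x := fun x hx => if_neg hx
  have hnA : ∀ z ∈ Z, ¬ A z := by
    rintro z hz (rfl | hz')
    · exact hs hz
    · rw [hfid z hz, h.self z] at hz'
      linarith [h.nonneg s z, hz'.2]
  have hs0 : ∀ x, A x → d s x ≤ d (f x) x := by
    rintro x (rfl | hx)
    · rw [h.self]; exact h.nonneg _ _
    · exact hx.2.le
  obtain ⟨τ, hinj, hτ⟩ := h.close (insert s Z) g ρ (by rw [card_insert_of_notMem hs, hZ]) hρ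
    (fun x => by
      by_cases hx : A x
      · simp [gpos x hx]
      · simp [gneg x hx, hfZ x])
    (fun x hx => by
      rcases mem_insert.1 hx with rfl | hx
      · exact gpos _ (Or.inl rfl)
      · rw [gneg x (hnA x hx), hfid x hx])
    (fun x => by
      by_cases hx : A x
      · rw [gpos x hx]; exact (hs0 x hx).trans (hfρ x)
      · rw [gneg x hx]; exact hfρ x)
    (fun x c hc => by
      by_cases hx : A x
      · rw [gpos x hx]
        rcases mem_insert.1 hc with rfl | hc
        · exact Or.inl le_rfl
        · exact Or.inl ((hs0 x hx).trans (hfmin x c hc))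
      · rw [gneg x hx]
        rcases mem_insert.1 hc with rfl | hc
        · simp only [hA, not_or, not_and_or, not_lt] at hx
          exact hx.2.symm
        · exact Or.inl (hfmin x c hc))
  refine ⟨τ, hinj, mostOf_of_card_le hτ fun x hx => ?_,
    fun z hz => mostOf_of_card_le hτ fun x hx => ?_⟩
  · by_contra hAx
    rw [gneg x hAx] at hx
    exact hs (hinj (by simp [hfZ x]) (by simp) hx ▸ hfZ x)
  · by_cases hAx : A x
    · rw [gpos x hAx] at hx
      exact absurd (hinj (by simp) (by simp [hz]) hx ▸ hz) hs
    · rw [gneg x hAx] at hx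
      exact hinj (by simp [hfZ x]) (by simp [hz]) hx

lemma exists_voronoi (h : StableInstance d r μ cl) {Z : Finset S} {ρ : ℝ} (hne : Z.Nonempty)
    (hcov : Covers d Z ρ) : ∃ f : S → S, (∀ x, f x ∈ Z) ∧ (∀ x ∈ Z, f x = x) ∧
      (∀ x, d (f x) x ≤ ρ) ∧ ∀ x, ∀ z ∈ Z, d (f x) x ≤ d z x := by
  have hex : ∀ x, ∃ y ∈ Z, (x ∈ Z → y = x) ∧ ∀ z ∈ Z, d y x ≤ d z x := by
    intro x
    by_cases hx : x ∈ Z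
    · exact ⟨x, hx, fun _ => rfl, fun z _ => by rw [h.self]; exact h.nonneg _ _⟩
    · obtain ⟨y, hy, hmin⟩ := exists_min_image Z (fun z => d z x) hne
      exact ⟨y, hy, fun hx' => absurd hx' hx, hmin⟩
  choose f hfZ hfid hfmin using hex
  refine ⟨f, hfZ, hfid, fun x => ?_, hfmin⟩
  obtain ⟨c, hc, hcx⟩ := hcov x
  exact (hfmin x c hc).trans hcx

/-- Relative to a set of `k - 1` centers covering everything within `ρ ≤ 3 r`, the other points
capture one of only two clusters. -/
lemma exists_two_types (h : StableInstance d r μ cl) {Z : Finset S} {ρ : ℝ} (hZ : #Z + 1 = k)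
    (hne : Z.Nonempty) (hρ : ρ ≤ 3 * r) (hcov : Covers d Z ρ) :
    ∃ a b : Fin k, ∀ s ∉ Z, Captures d μ cl s (ρ / 3) a ∨ Captures d μ cl s (ρ / 3) b := by
  obtain ⟨f, hfZ, hfid, hfρ, hfmin⟩ := h.exists_voronoi hne hcov
  set M : Fin k → S → Prop := fun u z => MostOf μ cl u fun x => f x = z
  have huniq : ∀ u z z', M u z → M u z' → z = z' := by
    intro u z z' hz hz'
    obtain ⟨x, -, h1, h2⟩ := h.exists_both hz hz'
    exact h1.symm.trans h2
  have hex : ∀ u, ∃ z ∈ Z, ∀ z' ∈ Z, M u z' → z' = z := by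
    intro u
    by_cases hu : ∃ z ∈ Z, M u z
    · obtain ⟨z, hz, hM⟩ := hu
      exact ⟨z, hz, fun z' _ hM' => huniq u _ _ hM' hM⟩
    · push Not at hu
      obtain ⟨z, hz⟩ := hne
      exact ⟨z, hz, fun z' hz' hM => absurd hM (hu z' hz')⟩
  choose c hcZ hc using hex
  obtain ⟨a, -, b, -, hab, hcab⟩ := exists_ne_map_eq_of_card_lt_of_maps_to
    (s := (univ : Finset (Fin k))) (t := Z) (f := c) (by simp; omega) (fun u _ => hcZ u)
  refine ⟨a, b, fun s hs => ?_⟩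
  obtain ⟨τ, hinj, hτs, hτZ⟩ := h.exists_labelling hZ hρ hfZ hfid hfρ hfmin hs
  have hcap : Captures d μ cl s (ρ / 3) (τ s) := by
    have hpos : 0 < ρ := by
      obtain ⟨x, -, hxs, hx⟩ := h.exists_ne hτs s
      have := h.nonneg s x
      rcases hx with hx | hx
      · exact absurd hx hxs
      · linarith [hx.1]
    refine MostOf.mono hτs fun x hx => ?_
    rcases hx with rfl | hx
    · rw [h.self]; positivity
    · exact hx.1
  have himg : (insert s Z).image τ = univ := by
    rw [← card_eq_iff_eq_univ, card_image_of_injOn hinj, card_insert_of_notMem hs, hZ]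
    simp
  have hlab : ∀ u, u ≠ τ s → τ (c u) = u := by
    intro u hu
    obtain ⟨z, hz, rfl⟩ := mem_image.1 (himg ▸ mem_univ u)
    rcases mem_insert.1 hz with rfl | hz
    · exact absurd rfl hu
    · rw [← hc _ z hz (hτZ z hz)]
  by_contra! hcon
  have ha : a ≠ τ s := by rintro rfl; exact hcon.1 hcap
  have hb : b ≠ τ s := by rintro rfl; exact hcon.2 hcap
  exact hab (by rw [← hlab a ha, ← hlab b hb, hcab])


lemma exists_pair_of_cover (h : StableInstance d r μ cl) {Z : Finset S} {ρ : ℝ} (hZ : #Z + 1 = k)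
    (hne : Z.Nonempty) (hρ : ρ ≤ 3 * r) (hcov : Covers d Z ρ)
    (hnb : ∀ z ∈ Z, ∃ y ∉ Z, d z y ≤ ρ / 3) {v x₀ : S} (hx₀ : x₀ ≠ v) (hx₀v : d x₀ v ≤ ρ / 3) :
    ∃ w₁ w₂, w₁ ≠ v ∧ w₂ ≠ v ∧ ∀ x, d w₁ x < ρ ∨ d w₂ x < ρ := by
  obtain ⟨a, b, hab⟩ := h.exists_two_types hZ hne hρ hcov
  have key : ∀ t, ∃ w, w ≠ v ∧ ∀ s ∉ Z, Captures d μ cl s (ρ / 3) t → d w s < 2 * ρ / 3 := by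
    intro t
    by_cases hs₀ : ∃ s₀, s₀ ≠ v ∧ Captures d μ cl s₀ (ρ / 3) t
    · obtain ⟨s₀, hs₀v, hs₀⟩ := hs₀
      refine ⟨s₀, hs₀v, fun s _ hst => ?_⟩
      linarith [h.dist_lt_of_captures hs₀ hst]
    · refine ⟨x₀, hx₀, fun s _ hst => ?_⟩
      have hpos := h.pos_of_captures hst
      obtain rfl : s = v := by
        by_contra hsv
        exact hs₀ ⟨s, hsv, hst⟩
      linarith
  obtain ⟨w₁, hw₁, h₁⟩ := key a
  obtain ⟨w₂, hw₂, h₂⟩ := key b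
  refine ⟨w₁, w₂, hw₁, hw₂, fun x => ?_⟩
  by_cases hx : x ∈ Z
  · obtain ⟨y, hy, hxy⟩ := hnb x hx
    rw [h.symm] at hxy
    refine (hab y hy).imp (fun hya => ?_) (fun hyb => ?_)
    · linarith [h.tri w₁ y x, h₁ y hy hya]
    · linarith [h.tri w₂ y x, h₂ y hy hyb]
  · refine (hab x hx).imp (fun hxa => ?_) (fun hxb => ?_)
    · linarith [h₁ x hx hxa, h.pos_of_captures hxa]
    · linarith [h₂ x hx hxb, h.pos_of_captures hxb]

lemma exists_superset_pair (h : StableInstance d r μ cl) (hk : 3 ≤ k) {v w₁ w₂ : S} (hw₁ : w₁ ≠ v)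
    (hw₂ : w₂ ≠ v) : ∃ Z : Finset S, w₁ ∈ Z ∧ w₂ ∈ Z ∧ v ∉ Z ∧ #Z + 1 = k ∧
      ∀ m, #{x ∈ Z | cl x = m} ≤ 2 := by
  have hex : ∀ m, ∃ x, cl x = m ∧ x ≠ v := by
    intro m
    obtain ⟨x, hx, hxv⟩ := exists_mem_ne (s := {x | cl x = m})
      (lt_trans (by norm_num) (h.three_lt_card m)) v
    exact ⟨x, by simpa using hx, hxv⟩
  choose t ht htv using hex
  set W : Finset S := {w₁, w₂} with hW
  set B : Finset S := W ∪ ({m | m ≠ cl w₁ ∧ m ≠ cl w₂} : Finset (Fin k)).image t with hB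
  have hBk : k ≤ #B := by
    have himg : (univ : Finset (Fin k)) ⊆ B.image cl := by
      intro m _
      by_cases hm : m ≠ cl w₁ ∧ m ≠ cl w₂
      · exact mem_image.2 ⟨t m, mem_union_right _ (mem_image_of_mem _ (by simpa using hm)), ht m⟩
      · rcases not_and_or.1 hm with hm | hm
        · exact mem_image.2 ⟨w₁, by simp [hB, hW], (not_not.1 hm).symm⟩
        · exact mem_image.2 ⟨w₂, by simp [hB, hW], (not_not.1 hm).symm⟩
    simpa using (card_le_card himg).trans card_image_le
  have hvB : v ∉ B := by
    simp only [hB, hW, mem_union, mem_insert, mem_singleton, mem_image, not_or]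
    exact ⟨⟨hw₁.symm, hw₂.symm⟩, fun ⟨m, _, hm⟩ => htv m hm⟩
  have hB2 : ∀ m, #{x ∈ B | cl x = m} ≤ 2 := by
    intro m
    by_cases hm : m ≠ cl w₁ ∧ m ≠ cl w₂
    · refine (card_le_card (t := {t m}) fun x hx => ?_).trans (by simp)
      simp only [hB, hW, mem_filter, mem_union, mem_insert, mem_singleton, mem_image] at hx ⊢
      obtain ⟨(rfl | rfl) | ⟨l, -, rfl⟩, rfl⟩ := hx
      · exact absurd rfl hm.1
      · exact absurd rfl hm.2
      · rw [ht]
    · refine (card_le_card (t := W) fun x hx => ?_).trans card_le_two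
      simp only [hB, mem_filter, mem_union, mem_image, mem_univ, true_and] at hx
      obtain ⟨hx | ⟨l, hl, rfl⟩, rfl⟩ := hx
      · exact hx
      · rw [ht] at hm
        exact absurd hl hm
  obtain ⟨Z, hWZ, hZB, hZ⟩ := exists_subsuperset_card_eq (n := k - 1)
    (subset_union_left : W ⊆ B) (card_le_two.trans (by omega)) ((Nat.sub_le k 1).trans hBk)
  exact ⟨Z, hWZ (by simp [hW]), hWZ (by simp [hW]), fun hv => hvB (hZB hv), by omega,
    fun m => (card_le_card (filter_subset_filter _ hZB)).trans (hB2 m)⟩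

lemma exists_pair_lt (h : StableInstance d r μ cl) (hk : 3 ≤ k) {ρ : ℝ} (hρ : ρ ≤ 3 * r)
    (hpair : ∀ v, ∃ w₁ w₂, w₁ ≠ v ∧ w₂ ≠ v ∧ ∀ x, d w₁ x ≤ ρ ∨ d w₂ x ≤ ρ) (v : S) :
    ∃ w₁ w₂, w₁ ≠ v ∧ w₂ ≠ v ∧ ∀ x, d w₁ x < ρ ∨ d w₂ x < ρ := by
  have hcov : ∀ u, ∃ Z : Finset S, u ∉ Z ∧ Z.Nonempty ∧ Covers d Z ρ ∧ #Z + 1 = k ∧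
      ∀ m, #{x ∈ Z | cl x = m} ≤ 2 := by
    intro u
    obtain ⟨w₁, w₂, hw₁, hw₂, hw⟩ := hpair u
    obtain ⟨Z, h₁, h₂, hu, hZ, hZm⟩ := h.exists_superset_pair hk hw₁ hw₂
    exact ⟨Z, hu, ⟨w₁, h₁⟩, fun x => (hw x).elim (fun hx => ⟨w₁, h₁, hx⟩) fun hx => ⟨w₂, h₂, hx⟩,
      hZ, hZm⟩
  have htyped : ∀ u, ∃ m, Captures d μ cl u (ρ / 3) m := by
    intro u
    obtain ⟨Z, hu, hne, hZcov, hZ, -⟩ := hcov u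
    obtain ⟨a, b, hab⟩ := h.exists_two_types hZ hne hρ hZcov
    exact (hab u hu).elim (fun ha => ⟨a, ha⟩) fun hb => ⟨b, hb⟩
  obtain ⟨Z, -, hne, hZcov, hZ, hZm⟩ := hcov v
  obtain ⟨m, hm⟩ := htyped v
  obtain ⟨x₀, -, hx₀, hx₀v⟩ := h.exists_ne hm v
  refine h.exists_pair_of_cover hZ hne hρ hZcov (fun z _ => ?_) hx₀ (h.symm v x₀ ▸ hx₀v.le)
  obtain ⟨l, hl⟩ := htyped z
  obtain ⟨y, -, hyZ, hy⟩ := h.exists_notMem hl Z (hZm l)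
  exact ⟨y, hyZ, hy.le⟩

lemma false_of_cover (h : StableInstance d r μ cl) (hk : 3 ≤ k) {Z : Finset S} (hZ : #Z + 1 = k)
    (hcov : Covers d Z (3 * r)) (hnb : ∀ z ∈ Z, ∃ y ∉ Z, d z y ≤ r) : False := by
  have hne : Z.Nonempty := card_pos.1 (by omega)
  set D : Finset ℝ := univ.image fun e : S × S => d e.1 e.2 with hD
  have hdD : ∀ x y, d x y ∈ D := fun x y => mem_image.2 ⟨(x, y), mem_univ _, rfl⟩
  set P : ℝ → Prop := fun ρ => ∀ v, ∃ w₁ w₂, w₁ ≠ v ∧ w₂ ≠ v ∧ ∀ x, d w₁ x ≤ ρ ∨ d w₂ x ≤ ρ with hP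
  have hlower : ∀ ρ, (∀ v, ∃ w₁ w₂, w₁ ≠ v ∧ w₂ ≠ v ∧ ∀ x, d w₁ x < ρ ∨ d w₂ x < ρ) →
      ∃ ρ' ∈ D, ρ' < ρ ∧ P ρ' := by
    intro ρ hlt
    have hDne : (D.filter (· < ρ)).Nonempty := by
      obtain ⟨z, -⟩ := hne
      obtain ⟨w₁, w₂, -, -, hw⟩ := hlt z
      rcases hw z with hw | hw
      · exact ⟨_, mem_filter.2 ⟨hdD _ _, hw⟩⟩
      · exact ⟨_, mem_filter.2 ⟨hdD _ _, hw⟩⟩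
    obtain ⟨hmD, hmρ⟩ := mem_filter.1 (max'_mem _ hDne)
    refine ⟨_, hmD, hmρ, fun v => ?_⟩
    obtain ⟨w₁, w₂, hw₁, hw₂, hw⟩ := hlt v
    exact ⟨w₁, w₂, hw₁, hw₂, fun x => (hw x).imp
      (fun hx => le_max' _ _ (mem_filter.2 ⟨hdD _ _, hx⟩))
      (fun hx => le_max' _ _ (mem_filter.2 ⟨hdD _ _, hx⟩))⟩
  obtain ⟨ρ₀, hρ₀D, hρ₀, hPρ₀⟩ := hlower (3 * r) fun v => by
    obtain ⟨y, hyv, -, hy⟩ := h.near v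
    exact h.exists_pair_of_cover hZ hne le_rfl hcov
      (fun z hz => by simpa using hnb z hz) hyv (by rw [h.symm]; linarith)
  obtain ⟨ρ, hρ, hmin⟩ := exists_min_image (D.filter fun ρ => ρ ≤ 3 * r ∧ P ρ) id
    ⟨ρ₀, mem_filter.2 ⟨hρ₀D, hρ₀.le, hPρ₀⟩⟩
  obtain ⟨-, hρr, hPρ⟩ := mem_filter.1 hρ
  obtain ⟨ρ', hρ'D, hρ', hPρ'⟩ := hlower ρ (h.exists_pair_lt hk hρr hPρ)
  exact absurd (hmin ρ' (mem_filter.2 ⟨hρ'D, hρ'.le.trans hρr, hPρ'⟩)) (not_le.2 hρ')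

lemma dist_le_of_center (h : StableInstance d r μ cl) {ctr : Fin k → S}
    (hctr : ∀ x, d (ctr (cl x)) x ≤ r) {p x : S} (hx : cl x = cl p) : d p x ≤ 2 * r := by
  have h₁ := hctr x
  have h₂ := hctr p
  rw [h.symm] at h₂
  rw [hx] at h₁
  linarith [h.tri p (ctr (cl p)) x]

lemma dist_le_of_crossing (h : StableInstance d r μ cl) {ctr : Fin k → S}
    (hctr : ∀ x, d (ctr (cl x)) x ≤ r) {p q x : S} (hpq : d p q ≤ r)
    (hx : cl x = cl p ∨ cl x = cl q) : d p x ≤ 3 * r := by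
  rcases hx with hx | hx
  · linarith [h.dist_le_of_center hctr hx, h.nonneg p q]
  · linarith [h.dist_le_of_center hctr hx, h.tri p q x]

/-- With at least three clusters, points of different clusters are at distance more than `r`. -/
lemma lt_dist_of_three_le (h : StableInstance d r μ cl) (hk : 3 ≤ k) {ctr : Fin k → S}
    (hcl : ∀ m, cl (ctr m) = m) (hctr : ∀ x, d (ctr (cl x)) x ≤ r) {p q : S} (hne : cl p ≠ cl q) :
    r < d p q := by
  by_contra! hpq
  have hr : 0 ≤ r := (h.nonneg p q).trans hpq
  set f : Fin k → S := fun l => if l = cl p then p else ctr l with hf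
  have hclf : ∀ l, cl (f l) = l := by
    intro l
    by_cases hl : l = cl p
    · simp [hf, hl]
    · simp [hf, hl, hcl]
  refine h.false_of_cover hk (Z := (univ.erase (cl q)).image f) ?_ (fun x => ?_) fun z hz => ?_
  · rw [card_image_of_injective _ (Function.LeftInverse.injective hclf),
      card_erase_of_mem (mem_univ _), card_univ, Fintype.card_fin]
    omega
  · by_cases hx : cl x = cl p ∨ cl x = cl q
    · exact ⟨p, mem_image.2 ⟨cl p, by simp [hne], by simp [hf]⟩,
        h.dist_le_of_crossing hctr hpq hx⟩
    · push Not at hx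
      exact ⟨ctr (cl x), mem_image.2 ⟨cl x, by simp [hx.2], by simp [hf, hx.1]⟩,
        (hctr x).trans (by linarith)⟩
  · obtain ⟨y, hyz, hcy, hy⟩ := h.near z
    refine ⟨y, fun hyZ => hyz ?_, hy⟩
    obtain ⟨l, -, rfl⟩ := mem_image.1 hz
    obtain ⟨l', -, rfl⟩ := mem_image.1 hyZ
    rw [hclf, hclf] at hcy
    rw [hcy]

lemma eq_or_eq_of_ne (hk : k = 2) {m m' : Fin k} (hm : m' ≠ m) (t : Fin k) : t = m ∨ t = m' := by
  subst hk
  omega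

lemma exists_ne_of_eq_two (hk : k = 2) (m : Fin k) : ∃ m', m' ≠ m := by
  subst hk
  exact ⟨m + 1, by omega⟩

lemma exists_capturesFrom (h : StableInstance d r μ cl) (hk : k = 2) {u s : S} {ρ : ℝ}
    (hρ : ρ ≤ 3 * r) (hu : ∀ x, d u x ≤ ρ) (hs : s ≠ u) : ∃ m, CapturesFrom d μ cl s u ρ m := by
  obtain ⟨τ, -, hτ, -⟩ := h.exists_labelling (Z := {u}) (by simp [hk]) hρ (f := fun _ => u)
    (by simp) (by simp) hu (by simp) (by simpa using hs)
  exact ⟨τ s, hτ⟩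

/-- With two clusters, if `s` captures one of them against `u` which loses all ties, then most
points of the other cluster are captured by `u` or out of reach of `s`. -/
lemma mostOf_other (h : StableInstance d r μ cl) (hk : k = 2) {u s : S} {ρ : ℝ} (hρ : ρ ≤ 3 * r)
    (hu : ∀ x, d u x ≤ ρ) (hs : s ≠ u) {m m' : Fin k} (hm : m' ≠ m)
    (hc : CapturesFrom d μ cl s u ρ m) :
    MostOf μ cl m' fun x => x = u ∨ ρ < d s x ∨ d u x < ρ / 3 ∧ d u x < d s x := by
  set B : S → Prop := fun x => x = u ∨ ρ < d s x ∨ d u x < ρ / 3 ∧ d u x < d s x with hB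
  set g : S → S := fun x => if B x then u else s with hg
  have gpos : ∀ x, B x → g x = u := fun x hx => if_pos hx
  have gneg : ∀ x, ¬ B x → g x = s := fun x hx => if_neg hx
  have hρ0 : 0 ≤ ρ := (h.nonneg u u).trans (hu u)
  have hBs : ¬ B s := by
    simp only [hB, h.self, not_or, not_and_or, not_lt]
    exact ⟨hs, hρ0, Or.inr (h.nonneg _ _)⟩
  obtain ⟨τ, hinj, hτ⟩ := h.close {u, s} g ρ (by rw [card_pair hs.symm, hk]) hρ
    (fun x => by
      by_cases hx : B x
      · simp [gpos x hx]
      · simp [gneg x hx])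
    (fun x hx => by
      rcases mem_insert.1 hx with rfl | hx
      · exact gpos _ (Or.inl rfl)
      · rw [mem_singleton.1 hx, gneg s hBs])
    (fun x => by
      by_cases hx : B x
      · rw [gpos x hx]; exact hu x
      · rw [gneg x hx]
        simp only [hB, not_or, not_lt] at hx
        exact hx.2.1)
    (fun x c hc => by
      simp only [mem_insert, mem_singleton] at hc
      by_cases hx : B x
      · rw [gpos x hx]
        rcases hc with rfl | rfl
        · exact Or.inl le_rfl
        · rcases hx with rfl | hx | hx
          · exact Or.inl (by rw [h.self]; exact h.nonneg _ _)
          · exact Or.inr (by linarith)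
          · exact Or.inl hx.2.le
      · rw [gneg x hx]
        rcases hc with rfl | rfl
        · simp only [hB, not_or, not_and_or, not_lt] at hx
          exact hx.2.2.symm
        · exact Or.inl le_rfl)
  have hτne : τ s ≠ τ u := fun heq => hs (hinj (by simp) (by simp) heq)
  have hmost : MostOf μ cl (τ u) B := mostOf_of_card_le hτ fun x hx => by
    by_contra hBx
    rw [gneg x hBx] at hx
    exact hτne hx
  rcases eq_or_eq_of_ne hk hm (τ u) with hτu | hτu
  · obtain ⟨x, -, hx, hBx⟩ := h.exists_both hc (hτu ▸ hmost)
    rcases hx with rfl | hx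
    · exact absurd hBx hBs
    · rcases hBx with rfl | hBx | hBx
      · rw [h.self] at hx
        exact absurd hx.2 (not_lt.2 (h.nonneg _ _))
      · linarith [hx.1]
      · linarith [hx.2, hBx.2]
  · exact hτu ▸ hmost

lemma captures_other (h : StableInstance d r μ cl) (hk : k = 2) {u s : S} {ρ : ℝ} (hρ : ρ ≤ 3 * r)
    (hu : ∀ x, d u x ≤ ρ) (hsρ : ∀ x, d s x ≤ ρ) (hs : s ≠ u) {m m' : Fin k} (hm : m' ≠ m)
    (hc : CapturesFrom d μ cl s u ρ m) : Captures d μ cl u (ρ / 3) m' := by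
  have hpos := h.pos_of_capturesFrom hc
  refine (h.mostOf_other hk hρ hu hs hm hc).mono fun x hx => ?_
  rcases hx with rfl | hx | hx
  · rw [h.self]; positivity
  · exact absurd hx (not_lt.2 (hsρ x))
  · exact hx.1

lemma exists_captures_pair (h : StableInstance d r μ cl) (hk : k = 2) {u s : S} {ρ : ℝ}
    (hρ : ρ ≤ 3 * r) (hu : ∀ x, d u x ≤ ρ) (hsρ : ∀ x, d s x ≤ ρ) (hs : s ≠ u) :
    ∃ m m', m' ≠ m ∧ Captures d μ cl s (ρ / 3) m ∧ Captures d μ cl u (ρ / 3) m' := by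
  obtain ⟨m, hm⟩ := h.exists_capturesFrom hk hρ hu hs
  obtain ⟨m', hm'⟩ := exists_ne_of_eq_two hk m
  exact ⟨m, m', hm', h.captures_of_capturesFrom hm, h.captures_other hk hρ hu hsρ hs hm' hm⟩

lemma exists_captures_all (h : StableInstance d r μ cl) (hk : k = 2) {ρ : ℝ} (hρ : ρ ≤ 3 * r)
    {a b c : S} (hab : a ≠ b) (hac : a ≠ c) (hbc : b ≠ c) (ha : ∀ x, d a x ≤ ρ)
    (hb : ∀ x, d b x ≤ ρ) (hc : ∀ x, d c x ≤ ρ) :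
    ∃ w, (∀ x, d w x ≤ ρ) ∧ ∀ m, Captures d μ cl w (ρ / 3) m := by
  have both : ∀ {w m m'}, m' ≠ m → Captures d μ cl w (ρ / 3) m → Captures d μ cl w (ρ / 3) m' →
      ∀ l, Captures d μ cl w (ρ / 3) l := by
    intro w m m' hm h₁ h₂ l
    rcases eq_or_eq_of_ne hk hm l with rfl | rfl
    · exact h₁
    · exact h₂
  obtain ⟨m, m', hm, ham, hbm⟩ := h.exists_captures_pair hk hρ hb ha hab
  obtain ⟨l, l', hl, hal, hcl⟩ := h.exists_captures_pair hk hρ hc ha hac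
  obtain ⟨n, n', hn, hbn, hcn⟩ := h.exists_captures_pair hk hρ hc hb hbc
  by_cases hml : l = m
  · subst hml
    obtain rfl : l' = m' := ((eq_or_eq_of_ne hk hm l').resolve_left hl)
    by_cases hnl : n = l
    · exact ⟨b, hb, both (fun heq => hm (heq.trans hnl)) hbn hbm⟩
    · obtain rfl : n = l' := (eq_or_eq_of_ne hk hl n).resolve_left hnl
      exact ⟨c, hc, both hn hcl hcn⟩
  · exact ⟨a, ha, both hml ham hal⟩

lemma le_of_forall_dist_le (h : StableInstance d r μ cl) (hk : k = 2) {u : S} {ρ : ℝ}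
    (hu : ∀ x, d u x ≤ ρ) : r ≤ ρ := by
  obtain ⟨y, hy, -⟩ := h.near u
  exact h.opt_le {u, y} ρ (by rw [card_pair hy.symm, hk]) fun x => ⟨u, by simp, hu x⟩

lemma dist_lt_of_capturesFrom (h : StableInstance d r μ cl) {u s t : S} {ρ : ℝ} {m : Fin k}
    (hs : CapturesFrom d μ cl s u ρ m) (ht : CapturesFrom d μ cl t u ρ m) :
    d s t < 2 * ρ / 3 := by
  linarith [h.dist_lt_of_captures (h.captures_of_capturesFrom hs) (h.captures_of_capturesFrom ht)]

/-- Two points capturing different clusters against a point `z` of minimal eccentricity are not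
close to each other, when one of them is close to `z`. -/
lemma false_of_mixed (h : StableInstance d r μ cl) (hk : k = 2) {z v s : S} {R : ℝ}
    (hR : R ≤ 3 * r) (hz : ∀ x, d z x ≤ R) (hmin : ∀ u, ∃ x, R ≤ d u x) {m m' : Fin k}
    (hm : m' ≠ m) (hv : CapturesFrom d μ cl v z R m) (hs : CapturesFrom d μ cl s z R m')
    (hsv : d s v < R / 3) (hzv : d z v < R) : False := by
  have hpos := h.pos_of_capturesFrom hv
  obtain ⟨t, ht⟩ := hmin v
  by_cases htz : t = z
  · rw [htz, h.symm] at ht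
    linarith
  obtain ⟨l, hl⟩ := h.exists_capturesFrom hk hR hz htz
  rcases eq_or_eq_of_ne hk hm l with rfl | rfl
  · linarith [h.dist_lt_of_capturesFrom hv hl]
  · have := h.dist_lt_of_capturesFrom hs hl
    rw [h.symm] at hsv
    linarith [h.tri v s t]

lemma exists_capturesFrom_near (h : StableInstance d r μ cl) (hk : k = 2) {z : S} {R ρ : ℝ}
    (hR : R ≤ 3 * r) (hz : ∀ x, d z x ≤ R) (hmin : ∀ u, ∃ x, R ≤ d u x) (hRρ : R ≤ ρ)
    (hρ : ρ ≤ 3 * r) {m m' : Fin k} (hm : m' ≠ m) (hcap : Captures d μ cl z (ρ / 3) m') :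
    ∃ x, x ≠ z ∧ CapturesFrom d μ cl x z R m' ∧ d z x < ρ / 3 := by
  have hrR := h.le_of_forall_dist_le hk hz
  by_cases hex : ∃ s, s ≠ z ∧ CapturesFrom d μ cl s z R m'
  · obtain ⟨s, hsz, hs⟩ := hex
    obtain ⟨x, -, hsx, hzx⟩ := h.exists_both (h.captures_of_capturesFrom hs) hcap
    by_cases hxz : x = z
    · rw [hxz, h.symm] at hsx
      exact ⟨s, hsz, hs, by linarith⟩
    obtain ⟨l, hl⟩ := h.exists_capturesFrom hk hR hz hxz
    rcases eq_or_eq_of_ne hk hm l with rfl | rfl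
    · exact (h.false_of_mixed hk hR hz hmin hm hl hs hsx (by linarith)).elim
    · exact ⟨x, hxz, hl, hzx⟩
  · have htyped : ∀ s, s ≠ z → CapturesFrom d μ cl s z R m := by
      intro s hs
      obtain ⟨l, hl⟩ := h.exists_capturesFrom hk hR hz hs
      rcases eq_or_eq_of_ne hk hm l with rfl | rfl
      · exact hl
      · exact absurd ⟨s, hs, hl⟩ hex
    obtain ⟨x, -, hxz, hx⟩ := h.exists_ne hcap z
    obtain ⟨t, ht⟩ := hmin x
    by_cases htz : t = z
    · rw [htz, h.symm] at ht
      linarith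
    · linarith [h.dist_lt_of_capturesFrom (htyped x hxz) (htyped t htz),
        h.pos_of_capturesFrom (htyped x hxz)]

lemma two_mul_lt_radius (h : StableInstance d r μ cl) (hk : k = 2) {z : S} {R : ℝ}
    (hz : ∀ x, d z x ≤ R) (hmin : ∀ u, ∃ x, R ≤ d u x) : 2 * r < R := by
  by_contra! hR2
  obtain ⟨y, hyz, -, hy⟩ := h.near z
  have hr : 0 ≤ r := (h.nonneg z y).trans hy
  have hR : R ≤ 3 * r := by linarith
  have hρ : r + R ≤ 3 * r := by linarith
  have hreach : ∀ w, d z w ≤ r → ∀ x, d w x ≤ r + R := fun w hw x => by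
    rw [h.symm] at hw
    linarith [h.tri w z x, hz x]
  have hcap : ∀ {w l l'}, w ≠ z → d z w ≤ r → l' ≠ l → CapturesFrom d μ cl w z R l →
      Captures d μ cl z ((r + R) / 3) l' := fun hw hwr hl hc =>
    h.captures_other hk hρ (fun x => (hz x).trans (by linarith)) (hreach _ hwr) hw hl
      (hc.mono (by linarith))
  obtain ⟨m, hm⟩ := h.exists_capturesFrom hk hR hz hyz
  obtain ⟨m', hm'⟩ := exists_ne_of_eq_two hk m
  have hcap' := hcap hyz hy hm' hm
  obtain ⟨x, hxz, hx, hzx⟩ := h.exists_capturesFrom_near hk hR hz hmin (by linarith) hρ hm' hcap'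
  have hcapm := hcap hxz (by linarith) hm'.symm hx
  obtain ⟨t, ht⟩ := hmin z
  have hRpos := h.pos_of_capturesFrom hm
  by_cases htz : t = z
  · rw [htz, h.self] at ht
    linarith
  obtain ⟨l, hl⟩ := h.exists_capturesFrom hk hR hz htz
  have hlR := h.captures_of_capturesFrom hl
  rcases eq_or_eq_of_ne hk hm' l with rfl | rfl
  · linarith [h.dist_lt_of_captures hcapm hlR, h.le_of_forall_dist_le hk hz]
  · linarith [h.dist_lt_of_captures hcap' hlR, h.le_of_forall_dist_le hk hz]

lemma false_of_three (h : StableInstance d r μ cl) (hk : k = 2) {z : S} {R : ℝ}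
    (hR : R ≤ 3 * r) (hz : ∀ x, d z x ≤ R) (hmin : ∀ u, ∃ x, R ≤ d u x)
    {a b c : S} (hab : a ≠ b) (hac : a ≠ c) (hbc : b ≠ c) (ha : ∀ x, d a x ≤ 3 * r)
    (hb : ∀ x, d b x ≤ 3 * r) (hc : ∀ x, d c x ≤ 3 * r) : False := by
  have hR2 := h.two_mul_lt_radius hk hz hmin
  obtain ⟨w, hw, hwm⟩ := h.exists_captures_all hk le_rfl hab hac hbc ha hb hc
  obtain ⟨t, ht⟩ := hmin w
  by_cases htz : t = z
  · by_cases hwz : w = z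
    · obtain ⟨y, -, -, hy⟩ := h.near z
      rw [htz, hwz, h.self] at ht
      linarith [h.nonneg z y]
    · obtain ⟨m, m', -, -, hzm⟩ :=
        h.exists_captures_pair hk le_rfl (fun x => (hz x).trans hR) hw hwz
      rw [htz] at ht
      linarith [h.dist_lt_of_captures (hwm m') hzm]
  · obtain ⟨l, hl⟩ := h.exists_capturesFrom hk hR hz htz
    linarith [h.dist_lt_of_captures (hwm l) (h.captures_of_capturesFrom hl)]

lemma false_of_near_center (h : StableInstance d r μ cl) (hk : k = 2) {z z₁ : S} {R : ℝ}
    (hz : ∀ x, d z x ≤ R) (hmin : ∀ u, ∃ x, R ≤ d u x) (hne : z₁ ≠ z)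
    (hz₁ : ∀ x, d z₁ x ≤ 3 * r) (hzz₁ : d z z₁ ≤ r) : False := by
  obtain ⟨x₀, -, hx₀⟩ := exists_max_image univ (d z₁) ⟨z, mem_univ z⟩
  set ρ := d z₁ x₀ with hρdef
  have hz₁ρ : ∀ x, d z₁ x ≤ ρ := fun x => hx₀ x (mem_univ x)
  have hρ : ρ ≤ 3 * r := hz₁ x₀
  have hRρ : R ≤ ρ := by
    obtain ⟨t, ht⟩ := hmin z₁
    exact ht.trans (hz₁ρ t)
  have hR : R ≤ 3 * r := hRρ.trans hρ
  have hrR := h.le_of_forall_dist_le hk hz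
  have hg := h.nonneg z z₁
  obtain ⟨m, hm⟩ := h.exists_capturesFrom hk hR hz hne
  obtain ⟨m', hm'⟩ := exists_ne_of_eq_two hk m
  have hRpos := h.pos_of_capturesFrom hm
  have hcap := h.captures_other hk hρ (fun x => (hz x).trans hRρ) hz₁ρ hne hm' (hm.mono hRρ)
  have hother : ∀ s, CapturesFrom d μ cl s z R m' → d z s < ρ / 3 + R / 3 := fun s hs =>
    h.dist_lt_of_captures hcap (h.captures_of_capturesFrom hs)
  have hclose : d z z₁ < ρ / 3 := by
    obtain ⟨x, hxz, hx, hzx⟩ := h.exists_capturesFrom_near hk hR hz hmin hRρ hρ hm' hcap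
    set ℓ := max ρ (R / 3 + d z z₁ + ρ / 3) with hℓdef
    have hρℓ : ρ ≤ ℓ := le_max_left _ _
    have hℓ : ℓ ≤ 3 * r := max_le hρ (by linarith)
    have hgℓ : d z z₁ < ℓ / 3 → d z z₁ < ρ / 3 := by
      rcases max_cases ρ (R / 3 + d z z₁ + ρ / 3) with hmax | hmax
      · rw [hℓdef, hmax.1]; exact id
      · rw [hℓdef, hmax.1]; intro; linarith
    obtain ⟨v, -, hv, hv'⟩ := h.exists_both (h.captures_of_capturesFrom hm)
      (h.mostOf_other hk hℓ (fun y => (hz y).trans (hRρ.trans hρℓ)) hxz hm'.symm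
        (hx.mono (hRρ.trans hρℓ)))
    by_cases hvz : v = z
    · rw [hvz, h.symm] at hv
      linarith
    have hzv : d z v < ℓ / 3 := by
      rcases hv' with hv' | hv' | hv'
      · exact absurd hv' hvz
      · rw [h.symm] at hzx
        linarith [h.tri x z v, h.tri z z₁ v, le_max_right ρ (R / 3 + d z z₁ + ρ / 3)]
      · exact hv'.1
    by_cases hvz₁ : v = z₁
    · exact hgℓ (hvz₁ ▸ hzv)
    exfalso
    obtain ⟨l, hl⟩ := h.exists_capturesFrom hk hR hz hvz
    rcases eq_or_eq_of_ne hk hm' l with rfl | rfl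
    · refine h.false_of_three hk hR hz hmin hne.symm (Ne.symm hvz) (Ne.symm hvz₁)
        (fun y => (hz y).trans hR) hz₁ fun t => ?_
      rw [h.symm] at hzv
      by_cases htz : t = z
      · rw [htz]; linarith
      obtain ⟨n, hn⟩ := h.exists_capturesFrom hk hR hz htz
      rcases eq_or_eq_of_ne hk hm' n with rfl | rfl
      · linarith [h.dist_lt_of_capturesFrom hl hn]
      · linarith [h.tri v z t, hother t hn]
    · exact h.false_of_mixed hk hR hz hmin hm'.symm hl hm hv (by linarith)
  by_cases hx₀z : x₀ = z
  · rw [hx₀z, h.symm] at hρdef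
    linarith
  obtain ⟨l, hl⟩ := h.exists_capturesFrom hk hR hz hx₀z
  rcases eq_or_eq_of_ne hk hm' l with rfl | rfl
  · linarith [h.dist_lt_of_capturesFrom hm hl]
  · linarith [h.tri z₁ z x₀, h.symm z z₁, hother x₀ hl]

/-- With two clusters, points of different clusters are at distance more than `r`. -/
lemma lt_dist_of_eq_two (h : StableInstance d r μ cl) (hk : k = 2) {ctr : Fin k → S}
    (hctr : ∀ x, d (ctr (cl x)) x ≤ r) {p q : S} (hne : cl p ≠ cl q) : r < d p q := by
  by_contra! hpq
  have hqp : d q p ≤ r := h.symm p q ▸ hpq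
  have hpq' : p ≠ q := fun heq => hne (heq ▸ rfl)
  have hcov := fun x => eq_or_eq_of_ne hk hne.symm (cl x)
  have hp : ∀ x, d p x ≤ 3 * r := fun x => h.dist_le_of_crossing hctr hpq (hcov x)
  have hq : ∀ x, d q x ≤ 3 * r := fun x => h.dist_le_of_crossing hctr hqp (hcov x).symm
  have hecc : ∀ u, ∃ x, ∀ y, d u y ≤ d u x := fun u => by
    obtain ⟨x, -, hx⟩ := exists_max_image univ (d u) ⟨p, mem_univ p⟩
    exact ⟨x, fun y => hx y (mem_univ y)⟩
  choose far hfar using hecc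
  obtain ⟨z, -, hzmin⟩ := exists_min_image univ (fun u => d u (far u)) ⟨p, mem_univ p⟩
  have hmin : ∀ u, ∃ x, d z (far z) ≤ d u x := fun u => ⟨far u, hzmin u (mem_univ u)⟩
  have hR : d z (far z) ≤ 3 * r := (hzmin p (mem_univ p)).trans (hp _)
  by_cases hzp : z = p
  · subst hzp
    exact h.false_of_near_center hk (hfar z) hmin hpq'.symm hq hpq
  by_cases hzq : z = q
  · subst hzq
    exact h.false_of_near_center hk (hfar z) hmin hpq' hp hqp
  exact h.false_of_three hk hR (hfar z) hmin hzp hzq hpq' (fun x => (hfar z x).trans hR) hp hq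

lemma lt_dist_of_ne (h : StableInstance d r μ cl) {ctr : Fin k → S} (hcl : ∀ m, cl (ctr m) = m)
    (hctr : ∀ x, d (ctr (cl x)) x ≤ r) {p q : S} (hne : cl p ≠ cl q) : r < d p q := by
  rcases Nat.lt_or_ge k 3 with hk | hk
  · refine h.lt_dist_of_eq_two ?_ hctr hne
    have := (cl p).2
    have := (cl q).2
    have := Fin.val_ne_of_ne hne
    omega
  · exact h.lt_dist_of_three_le hk hcl hctr hne

end StableInstance

lemma exists_relabelling {d : S → S → ℝ} {k : ℕ} {ε r : ℝ} {OPT : Clustering S k}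
    (hd : ∀ p q, 0 ≤ d p q) (hopt : IsOptCost d k r)
    (hres : EpsPerturbationResilient d k 3 ε OPT) {cl : S → Fin k}
    (hcl : ∀ x m, x ∈ OPT.C m ↔ cl x = m) {X : Finset S} {g : S → S} {ρ : ℝ} (hX : #X = k)
    (hρ : ρ ≤ 3 * r) (hgX : ∀ x, g x ∈ X) (hgid : ∀ x ∈ X, g x = x) (hgρ : ∀ x, d (g x) x ≤ ρ)
    (hgmin : ∀ x, ∀ c ∈ X, d (g x) x ≤ d c x ∨ ρ / 3 ≤ d c x) :
    ∃ τ : S → Fin k, Set.InjOn τ X ∧ (#{x | cl x ≠ τ (g x)} : ℝ) ≤ ε * Fintype.card S := by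
  set d' : S → S → ℝ := fun p q => max (d p q) (min (3 * d p q) ρ) with hd'
  have hgd' : ∀ x, d' (g x) x ≤ ρ := fun x => max_le (hgρ x) (min_le_right _ _)
  have hvor : ∀ x, ∀ c ∈ X, d' (g x) x ≤ d' c x := by
    intro x c hc
    rcases hgmin x c hc with hle | hle
    · exact max_le_max hle (min_le_min (by linarith) le_rfl)
    · refine (hgd' x).trans (le_max_of_le_right (le_min (by linarith) le_rfl))
  set e : Fin k ≃ X := (X.equivFinOfCardEq hX).symm with he
  let 𝒞 : Clustering S k :=
    { C := fun i => {x | g x = e i}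
      ctr := fun i => e i
      mem_ctr := fun i => by simpa using hgid _ (e i).2
      ctr_inj := fun i j hij => e.injective (Subtype.ext hij)
      covers := fun p => ⟨e.symm ⟨g p, hgX p⟩, by simp⟩
      disj := fun i j hij p hi hj => by
        simp only [mem_filter, mem_univ, true_and] at hi hj
        exact hij (e.injective (Subtype.ext (hi.symm.trans hj))) }
  have hmem : ∀ i x, x ∈ 𝒞.C i ↔ g x = e i := fun i x => by simp [𝒞]
  have hopt' : IsOptClustering d' k 𝒞 ρ := by
    refine ⟨fun i j p hp => ?_, fun i p hp => ?_, ⟨X, hX, fun p => ⟨g p, hgX p, hgd' p⟩⟩, ?_⟩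
    · change d' (e i) p ≤ d' (e j) p
      rw [← (hmem i p).1 hp]
      exact hvor p _ (e j).2
    · change d' (e i) p ≤ ρ
      rw [← (hmem i p).1 hp]
      exact hgd' p
    · intro Cs r' hCs hcov
      by_contra! hlt
      have := hopt.2 Cs (r' / 3) hCs fun p => by
        obtain ⟨c, hc, hcp⟩ := hcov p
        refine ⟨c, hc, ?_⟩
        rcases min_le_iff.1 ((le_max_right _ _).trans hcp) with hmin | hmin
        · linarith
        · linarith
      linarith
  obtain ⟨σ, hσ⟩ := hres d' (isPerturbation_max_min hd ρ) 𝒞 ρ hopt'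
  refine ⟨fun x => if hx : x ∈ X then σ (e.symm ⟨x, hx⟩) else cl x, fun x hx y hy hxy => ?_,
    le_trans ?_ hσ⟩
  · have hx' : x ∈ X := hx
    have hy' : y ∈ X := hy
    simp only [hx', hy', dif_pos] at hxy
    simpa using hxy
  · have hsub : ({x | cl x ≠ if hx : g x ∈ X then σ (e.symm ⟨g x, hx⟩) else cl (g x)} : Finset S) ⊆
        univ.biUnion fun i => 𝒞.C i \ OPT.C (σ i) := by
      intro x hx
      simp only [mem_filter, mem_univ, true_and, hgX x, dif_pos] at hx
      simp only [mem_biUnion, mem_univ, true_and, mem_sdiff, hmem, hcl]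
      exact ⟨e.symm ⟨g x, hgX x⟩, by simp, hx⟩
    exact_mod_cast (card_le_card hsub).trans card_biUnion_le

lemma stableInstance_of_resilient {d : S → S → ℝ} {k : ℕ} {ε r : ℝ} (hmet : IsQuasiMetric d)
    (hsym : SymmDist d) {OPT : Clustering S k} (hOPT : IsOptClustering d k OPT r)
    (hres : EpsPerturbationResilient d k 3 ε OPT)
    (hsize : ∀ i, max (2 * ε * Fintype.card S) 3 < ((OPT.C i).card : ℝ)) {cl : S → Fin k}
    (hcl : ∀ x m, x ∈ OPT.C m ↔ cl x = m) :
    StableInstance d r (ε * Fintype.card S) cl := by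
  have hC : ∀ m, OPT.C m = ({x | cl x = m} : Finset S) := fun m => by ext x; simp [hcl]
  have hcard : ∀ m, 3 < #({x | cl x = m} : Finset S) := fun m => by
    have := (le_max_right _ _).trans_lt (hsize m)
    rw [hC] at this
    exact_mod_cast this
  refine ⟨hmet.1, hmet.2.1, hmet.2.2, hsym, fun m => ?_, hcard, hOPT.2.2.2, fun v => ?_,
    fun X g ρ => exists_relabelling hmet.1 hOPT.2.2 hres hcl⟩
  · have := (le_max_left _ _).trans_lt (hsize m)
    rw [hC] at this
    linarith
  · have hctr := (hcl _ _).1 (OPT.mem_ctr (cl v))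
    by_cases hv : OPT.ctr (cl v) = v
    · obtain ⟨y, hy, hyv⟩ := exists_mem_ne ((show 1 < 3 by norm_num).trans (hcard (cl v))) v
      have hy' : cl y = cl v := by simpa using hy
      have := hOPT.2.1 (cl v) y ((hcl _ _).2 hy')
      rw [hv] at this
      exact ⟨y, hyv, hy', this⟩
    · exact ⟨_, hv, hctr, hsym v _ ▸ hOPT.2.1 (cl v) v ((hcl _ _).2 rfl)⟩

end StableInstance

/-- Under `(3, ε)`-perturbation resilience with all optimal clusters of
size `> max(2εn, 3)`, the optimal clusters are exactly the connected components of
the threshold graph at distance `r*`. -/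
theorem clusters_are_threshold_components {S : Type*} [Fintype S]
    (d : S → S → ℝ) (k : ℕ) (ε rstar : ℝ)
    (hmet : IsQuasiMetric d) (hsym : SymmDist d) (hε : 0 < ε)
    (OPT : Clustering S k) (hOPT : IsOptClustering d k OPT rstar)
    (hres : EpsPerturbationResilient d k 3 ε OPT)
    (hsize : ∀ i, max (2 * ε * Fintype.card S) 3 < ((OPT.C i).card : ℝ))
    (G : SimpleGraph S)
    (hG : ∀ p q : S, G.Adj p q ↔ p ≠ q ∧ d p q ≤ rstar) :
    ∀ p q : S, G.Reachable p q ↔ ∃ i, p ∈ OPT.C i ∧ q ∈ OPT.C i := by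
  choose cl hcl' using OPT.covers
  have hcl : ∀ x m, x ∈ OPT.C m ↔ cl x = m := fun x m =>
    ⟨fun hx => by_contra fun hne => OPT.disj _ _ hne x (hcl' x) hx, fun hx => hx ▸ hcl' x⟩
  have hst := stableInstance_of_resilient hmet hsym hOPT hres hsize hcl
  have hctr : ∀ x, d (OPT.ctr (cl x)) x ≤ rstar := fun x => hOPT.2.1 _ x (hcl' x)
  have hreach : ∀ x, G.Reachable (OPT.ctr (cl x)) x := fun x => by
    by_cases hx : OPT.ctr (cl x) = x
    · rw [hx]
    · exact ((hG _ _).2 ⟨hx, hctr x⟩).reachable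
  intro p q
  constructor
  · rintro ⟨w⟩
    refine ⟨cl p, hcl' p, (hcl q _).2 ?_⟩
    induction w with
    | nil => rfl
    | cons hadj _ ih =>
      refine ih.trans (by_contra fun hne => ?_)
      have := hst.lt_dist_of_ne (fun m => (hcl _ m).1 (OPT.mem_ctr m)) hctr (Ne.symm hne)
      exact absurd ((hG _ _).1 hadj).2 (not_le.2 this)
  · rintro ⟨i, hp, hq⟩
    have hpq : cl q = cl p := ((hcl q i).1 hq).trans ((hcl p i).1 hp).symm
    exact (hreach p).symm.trans (hpq ▸ hreach q)
end

section
/- Let (S,d) be a symmetric clustering instance with n ≥ 1 points and diameter D = max_{p,q∈S} d(p,q), let 1 ≤ k ≤ n, let α ≥ 1 and ε > 0, and let N be an integer with N ≥ n/ε. Form (S',d') by adding N new points p_1,…,p_N to S, setting d' = d on S × S, d'(p_i,q) = d'(q,p_i) = α(D+1) for every q ∈ S' with q ≠ p_i, and d'(p_i,p_i) = 0; set k' = k + N. Then: (i) d' is symmetric and satisfies the triangle inequality; (ii) for every r < D, there exist k centers in S such that every point of S is within distance r of some center under d if and only if there exist k' centers in S' such that every point of S' is within distance r of some center under d'; and (iii)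 (S',d') satisfies (α,ε)-perturbation resilience for k'-center. -/
open Finset
open scoped Classical

namespace Clustering

variable {T : Type*} [Fintype T] {m : ℕ}

lemma eq_of_mem (𝒞 : Clustering T m) {i j : Fin m} {p : T} (hi : p ∈ 𝒞.C i) (hj : p ∈ 𝒞.C j) :
    i = j := by
  by_contra h
  exact 𝒞.disj i j h p hi hj

end Clustering

/-- Two clusterings sharing the singleton clusters `{x a}` are `ε`-close as soon as the points
outside the range of `x` make up at most an `ε` fraction. -/
lemma epsClose_of_common_singletons {T ι : Type*} [Fintype T] {m : ℕ} {ε : ℝ}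
    (𝒞 𝒞' : Clustering T m) (x : ι → T) (hx : Function.Injective x)
    (h : ∀ a, ∃ i, 𝒞.C i = {x a}) (h' : ∀ a, ∃ i, 𝒞'.C i = {x a})
    (A : Finset T) (hA : ∀ p, p ∈ A ∨ ∃ a, x a = p) (hcard : (A.card : ℝ) ≤ ε * Fintype.card T) :
    EpsClose ε 𝒞 𝒞' := by
  choose f hf using h
  choose g hg using h'
  have hfi : Function.Injective f := fun a b hab => hx (by
    have := hf a
    rw [hab, hf b] at this
    exact (Finset.singleton_injective this).symm)
  have hgi : Function.Injective g := fun a b hab => hx (by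
    have := hg a
    rw [hab, hg b] at this
    exact (Finset.singleton_injective this).symm)
  let e : {i // i ∈ Set.range f} ≃ {i // i ∈ Set.range g} :=
    (Equiv.ofInjective f hfi).symm.trans (Equiv.ofInjective g hgi)
  have hσ : ∀ a, e.extendSubtype (f a) = g a := fun a => by
    rw [Equiv.extendSubtype_apply_of_mem e (f a) ⟨a, rfl⟩]
    simp [e]
  refine ⟨e.extendSubtype, le_trans ?_ hcard⟩
  rw [← Nat.cast_sum, Nat.cast_le, ← Finset.card_biUnion]
  · refine Finset.card_le_card fun p hp => ?_
    simp only [Finset.mem_biUnion, Finset.mem_univ, true_and, Finset.mem_sdiff] at hp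
    obtain ⟨i, hi, hi'⟩ := hp
    refine (hA p).resolve_right ?_
    rintro ⟨a, rfl⟩
    have : i = f a := 𝒞.eq_of_mem hi (by simp [hf])
    subst this
    exact hi' (by simp [hσ, hg])
  · intro i _ j _ hij
    refine Finset.disjoint_left.2 fun p hp hp' => hij ?_
    exact 𝒞.eq_of_mem (Finset.mem_sdiff.1 hp).1 (Finset.mem_sdiff.1 hp').1

/-- A point at distance more than the radius to and from every other point is a cluster by
itself. -/
lemma exists_singleton_cluster {T : Type*} [Fintype T] {m : ℕ} {d : T → T → ℝ} {r : ℝ}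
    {𝒞 : Clustering T m} (hr : HasRadius d 𝒞 r) (x : T)
    (hx : ∀ q, q ≠ x → r < d x q ∧ r < d q x) : ∃ i, 𝒞.C i = {x} := by
  obtain ⟨i, hi⟩ := 𝒞.covers x
  have hc : 𝒞.ctr i = x := by
    by_contra hne
    exact absurd (hr i x hi) (not_le.2 (hx _ hne).2)
  refine ⟨i, Finset.eq_singleton_iff_unique_mem.2 ⟨hi, fun q hq => ?_⟩⟩
  by_contra hne
  have := hr i q hq
  rw [hc] at this
  exact absurd this (not_le.2 (hx q hne).1)

/-- The centers in `Cs` together with all the added points cover as well as `Cs` did. -/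
lemma covers_disjSum_univ {S ι : Type*} [Fintype S] [Fintype ι] {d : S ⊕ ι → S ⊕ ι → ℝ}
    {Cs : Finset S} {r : ℝ} (h : ∀ p, ∃ c ∈ Cs, d (Sum.inl c) (Sum.inl p) ≤ r)
    (hι : ∀ i, d (Sum.inr i) (Sum.inr i) ≤ r) : Covers d (Cs.disjSum Finset.univ) r := by
  rintro (p | i)
  · obtain ⟨c, hc, hcp⟩ := h p
    exact ⟨_, Finset.inl_mem_disjSum.2 hc, hcp⟩
  · exact ⟨_, Finset.inr_mem_disjSum.2 (Finset.mem_univ i), hι i⟩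

/-- The hardness reduction instance. Adding `N ≥ n/ε` far-away points to
a symmetric instance `(S, d)` of diameter `D` yields a symmetric instance `(S', d₂)`
such that (i) `d₂` is a symmetric metric, (ii) for `r < D`, `k` centers cover `S`
within `r` under `d` iff `k + N` centers cover `S'` within `r` under `d₂`, and
(iii) `(S', d₂)` is `(α, ε)`-perturbation resilient for `(k + N)`-center. -/
theorem hardness_reduction_instance {S : Type*} [Fintype S] [Nonempty S]
    (d : S → S → ℝ) (hmet : IsQuasiMetric d) (hsym : SymmDist d)
    (D : ℝ) (hDub : ∀ p q : S, d p q ≤ D) (hDmem : ∃ p q : S, d p q = D)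
    (k : ℕ) (hk1 : 1 ≤ k) (hkn : k ≤ Fintype.card S)
    (α ε : ℝ) (hα : 1 ≤ α) (hε : 0 < ε)
    (N : ℕ) (hN : (Fintype.card S : ℝ) / ε ≤ N)
    (d2 : (S ⊕ Fin N) → (S ⊕ Fin N) → ℝ)
    (hd2S : ∀ p q : S, d2 (Sum.inl p) (Sum.inl q) = d p q)
    (hd2new : ∀ (i : Fin N) (q : S ⊕ Fin N), q ≠ Sum.inr i →
        d2 (Sum.inr i) q = α * (D + 1) ∧ d2 q (Sum.inr i) = α * (D + 1))
    (hd2self : ∀ i : Fin N, d2 (Sum.inr i) (Sum.inr i) = 0) :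
    (IsQuasiMetric d2 ∧ SymmDist d2) ∧
    (∀ r : ℝ, r < D →
      ((∃ Cs : Finset S, Cs.card = k ∧ Covers d Cs r) ↔
        (∃ Cs : Finset (S ⊕ Fin N), Cs.card = k + N ∧ Covers d2 Cs r))) ∧
    (∀ (OPT' : Clustering (S ⊕ Fin N) (k + N)) (r' : ℝ),
        IsOptClustering d2 (k + N) OPT' r' →
        EpsPerturbationResilient d2 (k + N) α ε OPT') := by
  have hd0 : ∀ p q, 0 ≤ d p q := hmet.1
  have hD0 : 0 ≤ D := by
    obtain ⟨p, q, h⟩ := hDmem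
    exact h ▸ hd0 p q
  have hDα : D < α * (D + 1) := by nlinarith
  have hle : ∀ p q, d2 p q ≤ α * (D + 1) := by
    rintro (p | i) q
    · rcases q with q | j
      · rw [hd2S]
        linarith [hDub p q]
      · exact (hd2new j _ (by simp)).2.le
    · by_cases h : q = Sum.inr i
      · rw [h, hd2self]
        linarith
      · exact (hd2new i q h).1.le
  have hnonneg : ∀ p q, 0 ≤ d2 p q := by
    rintro (p | i) q
    · rcases q with q | j
      · rw [hd2S]
        exact hd0 p q
      · rw [(hd2new j _ (by simp)).2]
        linarith
    · by_cases h : q = Sum.inr i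
      · rw [h, hd2self]
      · rw [(hd2new i q h).1]
        linarith
  have hself : ∀ p, d2 p p = 0 := by
    rintro (p | i)
    · rw [hd2S, hmet.2.1]
    · exact hd2self i
  have hsymm : SymmDist d2 := by
    rintro (p | i) (q | j)
    · rw [hd2S, hd2S, hsym]
    · rw [(hd2new j _ (by simp)).1, (hd2new j _ (by simp)).2]
    · rw [(hd2new i _ (by simp)).1, (hd2new i _ (by simp)).2]
    · by_cases h : i = j
      · rw [h]
      · rw [(hd2new i (Sum.inr j) (by simpa using Ne.symm h)).1,
          (hd2new i (Sum.inr j) (by simpa using Ne.symm h)).2]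
  have htri : ∀ p q r, d2 p r ≤ d2 p q + d2 q r := by
    intro p q r
    by_cases hpq : p = q
    · rw [hpq, hself, zero_add]
    by_cases hqr : q = r
    · rw [hqr, hself, add_zero]
    have h1 := hnonneg p q
    have h2 := hnonneg q r
    have h3 := hle p r
    rcases p with p | i
    · rcases q with q | j
      · rcases r with r | l
        · simpa only [hd2S] using hmet.2.2 p q r
        · rw [(hd2new l (Sum.inl q) (by simp)).2]
          linarith
      · rw [(hd2new j (Sum.inl p) (by simp)).2]
        linarith
    · rw [(hd2new i q (Ne.symm hpq)).1]
      linarith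
  refine ⟨⟨⟨hnonneg, hself, htri⟩, hsymm⟩, fun r hr => ⟨?_, ?_⟩, ?_⟩
  · rintro ⟨Cs, hcard, hcov⟩
    have hr0 : 0 ≤ r := by
      obtain ⟨c, -, hc⟩ := hcov (Classical.arbitrary S)
      exact (hd0 _ _).trans hc
    exact ⟨Cs.disjSum Finset.univ, by simp [Finset.card_disjSum, hcard],
      covers_disjSum_univ (by simpa only [hd2S, Covers] using hcov) fun i => (hd2self i).trans_le hr0⟩
  · rintro ⟨Cs, hcard, hcov⟩
    have hright : Cs.toRight = Finset.univ := by
      refine Finset.eq_univ_of_forall fun i => Finset.mem_toRight.2 ?_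
      obtain ⟨c, hc, hci⟩ := hcov (Sum.inr i)
      by_cases h : c = Sum.inr i
      · exact h ▸ hc
      · rw [(hd2new i c h).2] at hci
        linarith
    refine ⟨Cs.toLeft, ?_, fun p => ?_⟩
    · have := Cs.card_toLeft_add_card_toRight
      rw [hright, Finset.card_univ, Fintype.card_fin] at this
      omega
    · obtain ⟨c | i, hc, hcp⟩ := hcov (Sum.inl p)
      · exact ⟨c, Finset.mem_toLeft.2 hc, hd2S c p ▸ hcp⟩
      · rw [(hd2new i _ (by simp)).1] at hcp
        linarith
  · have key : ∀ d' : S ⊕ Fin N → S ⊕ Fin N → ℝ, IsPerturbation α d2 d' →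
        ∀ (𝒞 : Clustering (S ⊕ Fin N) (k + N)) (r : ℝ), IsOptClustering d' (k + N) 𝒞 r →
        ∀ i : Fin N, ∃ j, 𝒞.C j = {Sum.inr i} := by
      intro d' hd' 𝒞 r hopt i
      have hdiag : ∀ p, d' p p ≤ 0 := fun p => by
        simpa [hself] using (hd' p p).2
      have hin : ∀ p q : S, d' (Sum.inl p) (Sum.inl q) ≤ α * D := fun p q => by
        refine (hd' _ _).2.trans ?_
        rw [hd2S]
        exact mul_le_mul_of_nonneg_left (hDub p q) (by linarith)
      obtain ⟨Cs, -, hCs⟩ := Finset.exists_subset_card_eq (s := (Finset.univ : Finset S)) hkn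
      obtain ⟨c, hc⟩ : Cs.Nonempty := Finset.card_pos.1 (by omega)
      have hr : r ≤ α * D := by
        refine hopt.2.2.2 (Cs.disjSum Finset.univ) _ (by simp [Finset.card_disjSum, hCs]) ?_
        exact covers_disjSum_univ (fun p => ⟨c, hc, hin c p⟩)
          fun i => (hdiag _).trans (by positivity)
      have hlt : r < α * (D + 1) := by linarith
      refine exists_singleton_cluster hopt.2.1 _ fun q hq => ?_
      have h := hd2new i q hq
      exact ⟨hlt.trans_le (h.1 ▸ (hd' _ _).1), hlt.trans_le (h.2 ▸ (hd' _ _).1)⟩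
    intro OPT' r' hOPT d' hd' 𝒞 r hopt
    have hrefl : IsPerturbation α d2 d2 := fun p q =>
      ⟨le_rfl, le_mul_of_one_le_left (hnonneg p q) hα⟩
    refine epsClose_of_common_singletons 𝒞 OPT' Sum.inr Sum.inr_injective
      (key d' hd' 𝒞 r hopt) (key d2 hrefl OPT' r' hOPT)
      (Finset.univ.map Function.Embedding.inl) ?_ ?_
    · rintro (p | i)
      · exact Or.inl (by simp)
      · exact Or.inr ⟨i, rfl⟩
    · rw [Finset.card_map, Finset.card_univ, Fintype.card_sum, Fintype.card_fin]
      rw [div_le_iff₀ hε] at hN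
      push_cast
      nlinarith [mul_nonneg hε.le (Nat.cast_nonneg (α := ℝ) (Fintype.card S))]
end

section
/- Let (S,d) be an asymmetric clustering instance satisfying (3,ε)-perturbation resilience for k-center, and let C ⊆ S with |C| = k be such that for every p ∈ S there exists c ∈ C with d(c,p) ≤ 3r*. Then the Voronoi partition of S induced by C under d (assigning each point to a closest center in C) is ε-close to OPT. -/
open Finset
open scoped Classical

/-- Scale by `3`, but truncate at `3 * r` the values that were at most `3 * r`. -/
noncomputable def truncTriple (r x : ℝ) : ℝ := if x ≤ 3 * r then min (3 * r) (3 * x) else 3 * x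

lemma truncTriple_le (r x : ℝ) : truncTriple r x ≤ 3 * x := by
  unfold truncTriple
  split_ifs
  exacts [min_le_right _ _, le_rfl]

lemma le_truncTriple {r x : ℝ} (hx : 0 ≤ x) : x ≤ truncTriple r x := by
  unfold truncTriple
  split_ifs with h
  · exact le_min h (by linarith)
  · linarith

lemma truncTriple_le_of_le {r x : ℝ} (h : x ≤ 3 * r) : truncTriple r x ≤ 3 * r := by
  rw [truncTriple, if_pos h]
  exact min_le_left _ _

lemma three_mul_le_of_truncTriple_le {r x b : ℝ} (h : truncTriple r x ≤ b) (hb : b < 3 * r) :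
    3 * x ≤ b := by
  unfold truncTriple at h
  split_ifs at h with hx
  · exact (min_le_iff.mp h).resolve_left (not_le.mpr hb)
  · exact h

lemma truncTriple_mono (r : ℝ) : Monotone (truncTriple r) := by
  intro x y hxy
  by_cases hy : y ≤ 3 * r
  · rw [truncTriple, truncTriple, if_pos hy, if_pos (hxy.trans hy)]
    exact min_le_min_left _ (by linarith)
  · refine (truncTriple_le r x).trans ?_
    rw [truncTriple, if_neg hy]
    linarith

/-- Truncated tripling multiplies the optimal cost by `3` as soon as a `3`-approximation exists. -/
lemma IsOptCost.truncTriple {S : Type*} [Fintype S] {d : S → S → ℝ} {k : ℕ} {r : ℝ}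
    (h : IsOptCost d k r) {Cs : Finset S} (hcard : Cs.card = k) (hcov : Covers d Cs (3 * r)) :
    IsOptCost (fun p q => truncTriple r (d p q)) k (3 * r) := by
  refine ⟨⟨Cs, hcard, fun p => ?_⟩, fun Ds b hD hb => ?_⟩
  · obtain ⟨c, hc, hcp⟩ := hcov p
    exact ⟨c, hc, truncTriple_le_of_le hcp⟩
  · by_contra! hlt
    have := h.2 Ds (b / 3) hD fun p => by
      obtain ⟨c, hc, hcp⟩ := hb p
      exact ⟨c, hc, by linarith [three_mul_le_of_truncTriple_le hcp hlt]⟩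
    linarith

/-- A set of `k` points containing all centers of a `k`-clustering consists of its centers. -/
lemma Clustering.exists_ctr_eq {S : Type*} [Fintype S] {k : ℕ} (𝒞 : Clustering S k)
    {Cs : Finset S} (hcard : Cs.card = k) (hctr : ∀ i, 𝒞.ctr i ∈ Cs) {c : S} (hc : c ∈ Cs) :
    ∃ i, 𝒞.ctr i = c := by
  obtain ⟨i, -, hi⟩ := Finset.surj_on_of_inj_on_of_card_le (s := Finset.univ) (t := Cs)
    (fun i _ => 𝒞.ctr i) (fun i _ => hctr i) (fun _ _ _ _ h => 𝒞.ctr_inj h) (by simp [hcard]) c hc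
  exact ⟨i, hi.symm⟩

/-- Under `(3, ε)`-perturbation resilience, the Voronoi partition
induced by any set of `k` centers which is a 3-approximation is `ε`-close to OPT. -/
theorem three_approximation_eps_close {S : Type*} [Fintype S]
    (d : S → S → ℝ) (k : ℕ) (ε rstar : ℝ)
    (hmet : IsQuasiMetric d) (hε : 0 < ε)
    (OPT : Clustering S k) (hOPT : IsOptClustering d k OPT rstar)
    (hres : EpsPerturbationResilient d k 3 ε OPT)
    (Cs : Finset S) (hcard : Cs.card = k)
    (hcov : Covers d Cs (3 * rstar))
    (𝒞 : Clustering S k) (hctr : ∀ i, 𝒞.ctr i ∈ Cs)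
    (hvor : IsVoronoi d 𝒞) :
    EpsClose ε 𝒞 OPT := by
  refine hres (fun p q => truncTriple rstar (d p q))
    (fun p q => ⟨le_truncTriple (hmet.1 p q), truncTriple_le _ _⟩) 𝒞 (3 * rstar)
    ⟨fun i j p hp => truncTriple_mono _ (hvor i j p hp), fun i p hp => ?_,
      hOPT.2.2.truncTriple hcard hcov⟩
  obtain ⟨c, hc, hcp⟩ := hcov p
  obtain ⟨j, rfl⟩ := 𝒞.exists_ctr_eq hcard hctr hc
  exact truncTriple_le_of_le ((hvor i j p hp).trans hcp)
end

section
/- Let G = (V,E) be a finite directed graph with no self-loops in which every vertex has out-degree at most 1. Then there exists a set I ⊆ V with |I| ≥ ⌈|V|/3⌉ such that for all distinct u,v ∈ I, neither (u,v) nor (v,u) is an edge of G. -/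
open Finset
open scoped Classical

/-- If every vertex has out-degree at most 1, then every nonempty finite set of vertices
contains a vertex of in-degree at most 1 within that set. -/
theorem exists_card_inNeighbors_le_one {V : Type*} (E : V → V → Prop)
    (hout : ∀ v u w, E v u → E v w → u = w) {S : Finset V} (hS : S.Nonempty) :
    ∃ v ∈ S, #{u ∈ S | E u v} ≤ 1 := by
  refine exists_le_of_sum_le hS ?_
  calc ∑ v ∈ S, #{u ∈ S | E u v} = ∑ u ∈ S, #{v ∈ S | E u v} :=
        (sum_card_bipartiteAbove_eq_sum_card_bipartiteBelow E).symm
    _ ≤ ∑ _u ∈ S, 1 := sum_le_sum fun u _ => card_le_one.2 fun a ha b hb =>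
        hout u a b (mem_filter.1 ha).2 (mem_filter.1 hb).2

/-- In a loopless directed graph with out-degree at most 1, every finite set of vertices has an
independent subset containing at least a third of it. -/
theorem exists_independent_subset_three_mul_card {V : Type*} (E : V → V → Prop)
    (hloop : ∀ v, ¬ E v v) (hout : ∀ v u w, E v u → E v w → u = w) (S : Finset V) :
    ∃ I ⊆ S, #S ≤ 3 * #I ∧ ∀ u ∈ I, ∀ v ∈ I, ¬ E u v := by
  induction S using Finset.strongInduction with
  | H S ih =>
    rcases S.eq_empty_or_nonempty with rfl | hS
    · exact ⟨∅, by simp⟩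
    obtain ⟨v, hv, hin⟩ := exists_card_inNeighbors_le_one E hout hS
    have hout' : #{u ∈ S | E v u} ≤ 1 := card_le_one.2 fun a ha b hb =>
      hout v a b (mem_filter.1 ha).2 (mem_filter.1 hb).2
    obtain ⟨N, hN⟩ : ∃ N : Finset V, N = insert v ({u ∈ S | E u v} ∪ {u ∈ S | E v u}) := ⟨_, rfl⟩
    have hNcard : #N ≤ 3 := by
      rw [hN]
      have h₁ := card_insert_le v ({u ∈ S | E u v} ∪ {u ∈ S | E v u})
      have h₂ := card_union_le {u ∈ S | E u v} {u ∈ S | E v u}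
      omega
    have hvN : v ∈ N := hN ▸ mem_insert_self _ _
    have hssub : S \ N ⊂ S :=
      (ssubset_iff_of_subset sdiff_subset).2 ⟨v, hv, fun h => (mem_sdiff.1 h).2 hvN⟩
    obtain ⟨I, hIS, hcard, hI⟩ := ih (S \ N) hssub
    have hadj : ∀ u ∈ I, ¬ E u v ∧ ¬ E v u := fun u hu => by
      have h := mem_sdiff.1 (hIS hu)
      simp only [hN, mem_insert, mem_union, mem_filter] at h
      tauto
    have hvI : v ∉ I := fun h => (mem_sdiff.1 (hIS h)).2 hvN
    refine ⟨insert v I, insert_subset hv (hIS.trans sdiff_subset), ?_, ?_⟩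
    · rw [card_insert_of_notMem hvI]
      have := le_card_sdiff N S
      omega
    · intro a ha b hb
      rcases mem_insert.1 ha with rfl | ha' <;> rcases mem_insert.1 hb with rfl | hb'
      · exact hloop _
      · exact (hadj b hb').2
      · exact (hadj a ha').1
      · exact hI a ha' b hb'

/-- In a finite loopless directed graph with out-degree at most 1,
there is a set of at least `⌈|V|/3⌉` vertices with no edges among them. -/
theorem independent_set_outdegree_one (V : Type*) [Fintype V]
    (E : V → V → Prop)
    (hloop : ∀ v, ¬ E v v)
    (hout : ∀ v u w, E v u → E v w → u = w) :
    ∃ I : Finset V, (Fintype.card V + 2) / 3 ≤ I.card ∧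
      ∀ u ∈ I, ∀ v ∈ I, u ≠ v → ¬ E u v ∧ ¬ E v u := by
  obtain ⟨I, -, hcard, hI⟩ := exists_independent_subset_three_mul_card E hloop hout univ
  rw [card_univ] at hcard
  exact ⟨I, by omega, fun u hu v hv _ => ⟨hI u hu v hv, hI v hv u hu⟩⟩
end

section
/- Let G = (V,E) be a finite simple graph with |V| = n and let 1 ≤ k < n. Suppose G has exactly one dominating set of size at most k, call it D, with |D| = k; suppose D is perfect, i.e., every v ∈ V \ D is adjacent to exactly one member of D; and suppose every member of D is adjacent to at least n/(2k) vertices of V \ D. Define d(u,v) = 0 if u = v, d(u,v) = 1 if {u,v} ∈ E, and d(u,v) = 2 otherwise. Then (V,d) is a symmetric clustering instance (d satisfies the triangle inequality), its optimal k-center cost is 1, the partition of V into k parts obtained by assigning each v ∈ V \ D to its unique neighbor in D is the unique partition of V into k parts with designated centers of cost at most 1, and every part of this partition has size at least n/(2k) + 1. -/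
open Finset
open scoped Classical

section OneTwoDistance

variable {V : Type*} [DecidableEq V] {G : SimpleGraph V} [DecidableRel G.Adj] {d : V → V → ℝ}

theorem oneTwoDist_le_one_iff
    (hd : ∀ u v, d u v = if u = v then 0 else if G.Adj u v then 1 else 2) (u v : V) :
    d u v ≤ 1 ↔ u = v ∨ G.Adj u v := by
  rw [hd]
  split_ifs with h h' <;> simp_all

theorem one_le_oneTwoDist
    (hd : ∀ u v, d u v = if u = v then 0 else if G.Adj u v then 1 else 2) {u v : V}
    (h : u ≠ v) : 1 ≤ d u v := by
  rw [hd, if_neg h]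
  split_ifs <;> norm_num

theorem oneTwoDist_symmDist
    (hd : ∀ u v, d u v = if u = v then 0 else if G.Adj u v then 1 else 2) : SymmDist d := by
  intro u v
  simp only [hd, eq_comm, G.adj_comm]

theorem oneTwoDist_isQuasiMetric
    (hd : ∀ u v, d u v = if u = v then 0 else if G.Adj u v then 1 else 2) :
    IsQuasiMetric d := by
  have h0 : ∀ u, d u u = 0 := fun u => by simp [hd]
  have hnonneg : ∀ u v, 0 ≤ d u v := fun u v => by
    rw [hd]
    split_ifs <;> norm_num
  have h2 : ∀ u v, d u v ≤ 2 := fun u v => by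
    rw [hd]
    split_ifs <;> norm_num
  refine ⟨hnonneg, h0, fun p q r => ?_⟩
  by_cases hpq : p = q
  · subst hpq
    simp [h0]
  by_cases hqr : q = r
  · subst hqr
    simp [h0]
  linarith [h2 p r, one_le_oneTwoDist hd hpq, one_le_oneTwoDist hd hqr]

/-- A set is dominating exactly when it has covering radius at most one. -/
theorem covers_one_iff_dominating
    (hd : ∀ u v, d u v = if u = v then 0 else if G.Adj u v then 1 else 2) (D : Finset V) :
    Covers d D 1 ↔ ∀ v, v ∉ D → ∃ u ∈ D, G.Adj v u := by
  simp only [Covers, oneTwoDist_le_one_iff hd]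
  constructor
  · intro h v hv
    obtain ⟨c, hc, rfl | hcv⟩ := h v
    · exact absurd hc hv
    · exact ⟨c, hc, hcv.symm⟩
  · intro h v
    by_cases hv : v ∈ D
    · exact ⟨v, hv, Or.inl rfl⟩
    · obtain ⟨u, hu, huv⟩ := h v hv
      exact ⟨u, hu, Or.inr huv.symm⟩

variable [Fintype V]

theorem one_le_of_covers
    (hd : ∀ u v, d u v = if u = v then 0 else if G.Adj u v then 1 else 2)
    {D : Finset V} (hD : D.card < Fintype.card V) {r : ℝ} (h : Covers d D r) : 1 ≤ r := by
  obtain ⟨v, hv⟩ : ∃ v, v ∉ D := by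
    by_contra! hall
    exact hD.ne (by rw [Finset.eq_univ_of_forall hall, Finset.card_univ])
  obtain ⟨c, hc, hcv⟩ := h v
  exact (one_le_oneTwoDist hd (ne_of_mem_of_not_mem hc hv)).trans hcv

/-- A clustering of radius one whose centers form a perfect dominating set assigns each
remaining point to its unique neighboring center. -/
theorem Clustering.mem_iff_of_hasRadius_one
    (hd : ∀ u v, d u v = if u = v then 0 else if G.Adj u v then 1 else 2)
    {k : ℕ} (𝒞 : Clustering V k) (h𝒞 : HasRadius d 𝒞 1) {D : Finset V}
    (hctr : ∀ v, v ∈ D ↔ ∃ i, 𝒞.ctr i = v)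
    (hperf : ∀ v, v ∉ D → ∃! u, u ∈ D ∧ G.Adj v u) (i : Fin k) (v : V) :
    v ∈ 𝒞.C i ↔ v = 𝒞.ctr i ∨ v ∉ D ∧ G.Adj v (𝒞.ctr i) := by
  have hmem : ∀ j, 𝒞.ctr j ∈ D := fun j => (hctr _).2 ⟨j, rfl⟩
  constructor
  · intro hv
    by_cases hvD : v ∈ D
    · obtain ⟨j, rfl⟩ := (hctr v).1 hvD
      by_cases hij : i = j
      · exact Or.inl (by rw [hij])
      · exact absurd (𝒞.mem_ctr j) (𝒞.disj i j hij _ hv)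
    · rcases (oneTwoDist_le_one_iff hd _ _).1 (h𝒞 i v hv) with h | h
      · exact Or.inl h.symm
      · exact Or.inr ⟨hvD, h.symm⟩
  · rintro (rfl | ⟨hvD, hadj⟩)
    · exact 𝒞.mem_ctr i
    · obtain ⟨j, hj⟩ := 𝒞.covers v
      rcases (oneTwoDist_le_one_iff hd _ _).1 (h𝒞 j v hj) with h | h
      · exact absurd (h ▸ hmem j) hvD
      · have := (hperf v hvD).unique ⟨hmem j, h.symm⟩ ⟨hmem i, hadj⟩
        rwa [← 𝒞.ctr_inj this]

/-- The centers of a clustering of radius `r` have covering radius at most `r`. -/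
theorem HasRadius.covers_image_ctr {k : ℕ} {𝒞 : Clustering V k} {r : ℝ}
    (h : HasRadius d 𝒞 r) : Covers d (Finset.univ.image 𝒞.ctr) r := by
  intro p
  obtain ⟨i, hi⟩ := 𝒞.covers p
  exact ⟨𝒞.ctr i, Finset.mem_image_of_mem _ (Finset.mem_univ i), h i p hi⟩

end OneTwoDistance

/-- The clustering around a perfect dominating set, its elements being enumerated by `e`. -/
def SimpleGraph.dominatingClustering {V : Type*} [Fintype V] [DecidableEq V]
    (G : SimpleGraph V) [DecidableRel G.Adj] {k : ℕ} {D : Finset V} (e : Fin k ≃ D)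
    (hperf : ∀ v, v ∉ D → ∃! u, u ∈ D ∧ G.Adj v u) : Clustering V k where
  C i := insert (e i : V) (Finset.univ.filter (fun v => v ∉ D ∧ G.Adj v (e i)))
  ctr i := e i
  mem_ctr i := Finset.mem_insert_self _ _
  ctr_inj := Subtype.val_injective.comp e.injective
  covers p := by
    by_cases hp : p ∈ D
    · exact ⟨e.symm ⟨p, hp⟩, by simp⟩
    · obtain ⟨u, ⟨hu, hpu⟩, -⟩ := hperf p hp
      exact ⟨e.symm ⟨u, hu⟩, by simp [hp, hpu]⟩
  disj i j hij p hi hj := by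
    simp only [Finset.mem_insert, Finset.mem_filter, Finset.mem_univ, true_and] at hi hj
    apply hij
    apply e.injective
    apply Subtype.ext
    rcases hi with rfl | ⟨hp, hi⟩
    · rcases hj with h | ⟨hp, -⟩
      · exact h
      · exact absurd (e i).2 hp
    · rcases hj with rfl | ⟨-, hj⟩
      · exact absurd (e j).2 hp
      · exact (hperf p hp).unique ⟨(e i).2, hi⟩ ⟨(e j).2, hj⟩

/-- Reduction from Unambiguous-Balanced-Perfect Dominating Set to
`k`-center: the induced 1-2 distance is a symmetric metric whose optimal `k`-center
cost is 1, the partition assigning each non-dominator to its unique dominating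
neighbor is the unique `k`-partition with designated centers of cost at most 1,
and all its parts have size at least `n/(2k) + 1`. -/
theorem dominating_set_reduction {V : Type*} [Fintype V] [DecidableEq V]
    (G : SimpleGraph V) [DecidableRel G.Adj]
    (n k : ℕ) (hn : n = Fintype.card V) (hk1 : 1 ≤ k) (hkn : k < n)
    (D : Finset V) (hDcard : D.card = k)
    (hdom : ∀ v, v ∉ D → ∃ u ∈ D, G.Adj v u)
    (huniq : ∀ D' : Finset V, D'.card ≤ k →
      (∀ v, v ∉ D' → ∃ u ∈ D', G.Adj v u) → D' = D)
    (hperf : ∀ v, v ∉ D → ∃! u, u ∈ D ∧ G.Adj v u)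
    (hbal : ∀ u ∈ D, (n : ℝ) / (2 * k) ≤
      ((Finset.univ.filter (fun v => v ∉ D ∧ G.Adj u v)).card : ℝ))
    (d : V → V → ℝ)
    (hd : ∀ u v, d u v = if u = v then 0 else if G.Adj u v then 1 else 2) :
    IsQuasiMetric d ∧ SymmDist d ∧ IsOptCost d k 1 ∧
    ∃ 𝒞 : Clustering V k,
      (∀ i, 𝒞.ctr i ∈ D) ∧
      (∀ i, 𝒞.C i = insert (𝒞.ctr i)
        (Finset.univ.filter (fun v => v ∉ D ∧ G.Adj v (𝒞.ctr i)))) ∧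
      HasRadius d 𝒞 1 ∧
      (∀ i, (n : ℝ) / (2 * k) + 1 ≤ ((𝒞.C i).card : ℝ)) ∧
      (∀ 𝒞' : Clustering V k, HasRadius d 𝒞' 1 → SamePartition 𝒞' 𝒞) := by
  have hcov := covers_one_iff_dominating hd
  refine ⟨oneTwoDist_isQuasiMetric hd, oneTwoDist_symmDist hd,
    ⟨⟨D, hDcard, (hcov D).2 hdom⟩, fun Cs r' hCs h =>
      one_le_of_covers hd (by omega) h⟩, ?_⟩
  let e : Fin k ≃ D := (D.equivFinOfCardEq hDcard).symm
  have hmem : ∀ i v, v ∈ (G.dominatingClustering e hperf).C i ↔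
      v = e i ∨ v ∉ D ∧ G.Adj v (e i) := by
    simp [SimpleGraph.dominatingClustering]
  refine ⟨G.dominatingClustering e hperf, fun i => (e i).2, fun i => ?_, fun i p hp => ?_,
    fun i => ?_, fun 𝒞' h𝒞' => ?_⟩
  · ext v
    simp only [hmem, Finset.mem_insert, Finset.mem_filter, Finset.mem_univ, true_and]
    rfl
  · refine (oneTwoDist_le_one_iff hd _ _).2 ?_
    rcases (hmem i p).1 hp with h | h
    · exact Or.inl h.symm
    · exact Or.inr h.2.symm
  · have hcard : ((G.dominatingClustering e hperf).C i).card =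
        (Finset.univ.filter (fun v => v ∉ D ∧ G.Adj (e i) v)).card + 1 := by
      rw [← Finset.card_insert_of_notMem (a := (e i : V)) (by simp)]
      congr 1
      ext v
      simp [hmem, G.adj_comm]
    rw [hcard]
    push_cast
    linarith [hbal (e i) (e i).2]
  · have himage : Finset.univ.image 𝒞'.ctr = D :=
      huniq _ (Finset.card_image_le.trans (by simp)) ((hcov _).1 h𝒞'.covers_image_ctr)
    have hctr : ∀ v, v ∈ D ↔ ∃ i, 𝒞'.ctr i = v := fun v => by
      rw [← himage]
      simp
    let f : Fin k → Fin k := fun i => e.symm ⟨𝒞'.ctr i, (hctr _).2 ⟨i, rfl⟩⟩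
    have hf : Function.Injective f := fun i j hij =>
      𝒞'.ctr_inj (congrArg Subtype.val (e.symm.injective hij))
    refine ⟨Equiv.ofBijective f (Finite.injective_iff_bijective.1 hf), fun i => ?_⟩
    ext v
    rw [𝒞'.mem_iff_of_hasRadius_one hd h𝒞' hctr hperf, hmem]
    simp [f]
end

section
/- Let α ≥ 1 and ε ≥ 0, and let (S,d) be a (possibly asymmetric) clustering instance satisfying (α,ε)-approximation stability for k-center. Then (S,d) satisfies (α,ε)-perturbation resilience for k-center. -/
open Finset
open scoped Classical

/-- `(α, ε)`-approximation stability implies `(α, ε)`-perturbation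
resilience. -/
theorem approx_stability_implies_perturbation_resilience {S : Type*} [Fintype S]
    (d : S → S → ℝ) (k : ℕ) (α ε rstar : ℝ)
    (hmet : IsQuasiMetric d) (hα : 1 ≤ α) (hε : 0 ≤ ε)
    (OPT : Clustering S k) (hOPT : IsOptClustering d k OPT rstar)
    (hstab : ApproxStable d k α ε rstar OPT) :
    EpsPerturbationResilient d k α ε OPT := by
  intro d' hd' 𝒞 r ⟨_, hrad, _, hmin⟩
  obtain ⟨_, hOPTrad, _⟩ := hOPT
  have hr : r ≤ α * rstar := by
    refine hmin (univ.map ⟨OPT.ctr, OPT.ctr_inj⟩) _ (by simp) fun p => ?_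
    obtain ⟨i, hi⟩ := OPT.covers p
    refine ⟨OPT.ctr i, by simp, (hd' _ p).2.trans ?_⟩
    exact mul_le_mul_of_nonneg_left (hOPTrad i p hi) (zero_le_one.trans hα)
  exact hstab 𝒞 fun i p hp => (hd' _ p).1.trans ((hrad i p hp).trans hr)
end

section
/- Let (S,d) be a (possibly asymmetric) clustering instance with optimal k-center clustering C_1,…,C_k, optimal centers c_1,…,c_k and optimal radius r*. Then each cluster C_j has at most one first-order cluster-capturing center; that is, there is at most one index i ≠ j such that for every x ∉ {i,j}, more than half of the points p ∈ C_j satisfy d(c_i,p) < d(c_x,p) and d(c_i,p) ≤ r*. -/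
open Finset
open scoped Classical

/-- Each optimal cluster `C_j` has at most one first-order
cluster-capturing center. -/
theorem at_most_one_ccc {S : Type*} [Fintype S]
    (d : S → S → ℝ) (k : ℕ) (rstar : ℝ)
    (hmet : IsQuasiMetric d)
    (OPT : Clustering S k) (hOPT : IsOptClustering d k OPT rstar)
    (j i i' : Fin k) (hi : i ≠ j) (hi' : i' ≠ j)
    (hccc : ∀ x, x ≠ i → x ≠ j →
      (OPT.C j).card < 2 * ((OPT.C j).filter
        (fun p => d (OPT.ctr i) p < d (OPT.ctr x) p ∧ d (OPT.ctr i) p ≤ rstar)).card)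
    (hccc' : ∀ x, x ≠ i' → x ≠ j →
      (OPT.C j).card < 2 * ((OPT.C j).filter
        (fun p => d (OPT.ctr i') p < d (OPT.ctr x) p ∧ d (OPT.ctr i') p ≤ rstar)).card) :
    i = i' := by
  by_contra hne
  have h := hccc i' (Ne.symm hne) hi'
  have h' := hccc' i hne hi
  have hdisj : Disjoint
      ((OPT.C j).filter
        (fun p => d (OPT.ctr i) p < d (OPT.ctr i') p ∧ d (OPT.ctr i) p ≤ rstar))
      ((OPT.C j).filter
        (fun p => d (OPT.ctr i') p < d (OPT.ctr i) p ∧ d (OPT.ctr i') p ≤ rstar)) :=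
    Finset.disjoint_filter.mpr fun _ _ hp hp' => lt_asymm hp.1 hp'.1
  have hcard := Finset.card_union_of_disjoint hdisj
  rw [← Finset.filter_or] at hcard
  have hle := hcard.symm.trans_le (Finset.card_filter_le _ _)
  omega
end
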